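/- Let V be an irreducible five-dimensional complex representation of the simple group PSL2(F11). Then the third symmetric power S³V (of dimension 35) decomposes as a direct sum of: one copy of the trivial representation, one irreducible representation of dimension 10, and the two non-isomorphic irreducible representations of dimension 12. In particular, S³V contains exactly one trivial subrepresentation. -/

import Mathlib

/-- The simple group `PSL₂(F₁₁)`. -/
abbrev PSL2F11 : Type := Matrix.ProjectiveSpecialLinearGroup (Fin 2) (ZMod 11)

section SymmetricPower

variable (V : Type) [AddCommGroup V] [Module ℂ V]

/-- The `k`-th symmetric power `SᵏV`, realised (in characteristic zero) as the space of
homogeneous polynomial functions of degree `k` on the dual space `V∨`:  the span, inside the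
space of all functions `V∨ → ℂ`, of the functions `φ ↦ φ(v₁)⋯φ(v_k)` with `v₁, …, v_k ∈ V`. -/
noncomputable def symPow (k : ℕ) : Submodule ℂ (Module.Dual ℂ V → ℂ) :=
  Submodule.span ℂ {f | ∃ v : Fin k → V, f = fun φ => ∏ i, φ (v i)}

variable {V}

/-- The action of `g` induced on functions on `V∨` by a representation `ρ` on `V`; on `SᵏV`
this is the `k`-th symmetric power of `ρ`. -/
noncomputable def symAct (ρ : Representation ℂ PSL2F11 V) (g : PSL2F11)
    (f : Module.Dual ℂ V → ℂ) : Module.Dual ℂ V → ℂ :=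
  fun φ => f (φ ∘ₗ ρ g)

/-- A subspace of functions on `V∨` is a subrepresentation if it is stable under the group. -/
def IsSubrep (ρ : Representation ℂ PSL2F11 V)
    (W : Submodule ℂ (Module.Dual ℂ V → ℂ)) : Prop :=
  ∀ g : PSL2F11, ∀ f ∈ W, symAct ρ g f ∈ W

/-- A subrepresentation is irreducible if it has no proper nonzero subrepresentation. -/
def IsIrredSubrep (ρ : Representation ℂ PSL2F11 V)
    (W : Submodule ℂ (Module.Dual ℂ V → ℂ)) : Prop :=
  IsSubrep ρ W ∧ W ≠ ⊥ ∧
    ∀ U : Submodule ℂ (Module.Dual ℂ V → ℂ), U ≤ W → IsSubrep ρ U → U = ⊥ ∨ U = W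

/-- Two subrepresentations are isomorphic if some equivariant linear endomorphism of the ambient
space restricts to a linear isomorphism between them. -/
def SubrepIso (ρ : Representation ℂ PSL2F11 V)
    (W W' : Submodule ℂ (Module.Dual ℂ V → ℂ)) : Prop :=
  ∃ T : (Module.Dual ℂ V → ℂ) →ₗ[ℂ] (Module.Dual ℂ V → ℂ),
    Submodule.map T W = W' ∧ (∀ f ∈ W, T f = 0 → f = 0) ∧
    ∀ g : PSL2F11, ∀ f ∈ W, T (symAct ρ g f) = symAct ρ g (T f)

end SymmetricPower

namespace P11

abbrev SL11 : Type := Matrix.SpecialLinearGroup (Fin 2) (ZMod 11)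

instance : Fact (Nat.Prime 11) := ⟨by norm_num⟩
instance : Fact (Nat.Prime 5) := ⟨by norm_num⟩

def sU (j : ZMod 11) : SL11 := ⟨!![1, j; 0, 1], by simp [Matrix.det_fin_two]⟩
def sT : SL11 := ⟨!![2, 0; 0, 6], by simp [Matrix.det_fin_two]; decide⟩
def sW : SL11 := ⟨!![0, 1; -1, 0], by simp [Matrix.det_fin_two]⟩

def gU (j : ZMod 11) : PSL2F11 := QuotientGroup.mk (sU j)
def gT (k : ZMod 5) : PSL2F11 := QuotientGroup.mk (sT ^ k.val)
def gW : PSL2F11 := QuotientGroup.mk sW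

lemma mk_eq_of (x y : SL11) (h : x = y ∨ x = -y) :
    (QuotientGroup.mk x : PSL2F11) = QuotientGroup.mk y := by
  rcases h with h | h
  · rw [h]
  · rw [QuotientGroup.eq, h, Subgroup.mem_center_iff]
    intro g
    have : (-y)⁻¹ * y = -1 := by
      rw [inv_mul_eq_iff_eq_mul]; simp
    rw [this]; simp

lemma sl_ext (x y : SL11) (h : ∀ i j, x.1 i j = y.1 i j) : x = y := by
  ext i j; exact h i j

lemma gU_add (a b : ZMod 11) : gU (a + b) = gU a * gU b := by
  refine mk_eq_of _ (sU a * sU b) (Or.inl ?_)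
  apply Subtype.ext
  rw [Matrix.SpecialLinearGroup.coe_mul]
  simp [sU, add_comm]

lemma gU_zero : gU 0 = 1 := by
  refine mk_eq_of _ 1 (Or.inl ?_)
  apply Subtype.ext
  simp [sU, Matrix.one_fin_two]

lemma gT_zero : gT 0 = 1 := by
  refine mk_eq_of _ 1 (Or.inl ?_)
  simp

lemma sT_pow (k : ℕ) : (sT ^ k).1 = !![2 ^ k, 0; 0, 6 ^ k] := by
  induction k with
  | zero => simp [Matrix.one_fin_two]
  | succ n ih =>
    rw [pow_succ, Matrix.SpecialLinearGroup.coe_mul, ih]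
    simp [sT, pow_succ]

lemma gT_add (a b : ZMod 5) : gT (a + b) = gT a * gT b := by
  refine mk_eq_of _ (sT ^ a.val * sT ^ b.val) ?_
  have key : ∀ a b : ZMod 5, 
    ((2 : ZMod 11) ^ (a+b).val = 2 ^ a.val * 2 ^ b.val ∧ (6 : ZMod 11) ^ (a+b).val = 6 ^ a.val * 6 ^ b.val) ∨
    ((2 : ZMod 11) ^ (a+b).val = -(2 ^ a.val * 2 ^ b.val) ∧ (6 : ZMod 11) ^ (a+b).val = -(6 ^ a.val * 6 ^ b.val)) := by
    decide
  rcases key a b with ⟨h1, h2⟩ | ⟨h1, h2⟩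
  · left
    apply Subtype.ext
    rw [Matrix.SpecialLinearGroup.coe_mul]
    simp only [sT_pow, h1, h2]
    simp
  · right
    apply Subtype.ext
    rw [Matrix.SpecialLinearGroup.coe_neg, Matrix.SpecialLinearGroup.coe_mul]
    simp only [sT_pow, h1, h2]
    simp

lemma gT_gU (k : ZMod 5) (j : ZMod 11) : gT k * gU j = gU (4 ^ k.val * j) * gT k := by
  refine mk_eq_of (sT ^ k.val * sU j) (sU (4 ^ k.val * j) * sT ^ k.val) (Or.inl ?_)
  apply Subtype.ext
  simp only [Matrix.SpecialLinearGroup.coe_mul, sT_pow]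
  have : ∀ (k : ZMod 5), (2 : ZMod 11) ^ k.val  = 4 ^ k.val * 6 ^ k.val := by decide
  simp [sU, this]
  ring

lemma gW_gW : gW * gW = 1 := by
  refine mk_eq_of (sW * sW) 1 (Or.inr ?_)
  apply Subtype.ext
  rw [Matrix.SpecialLinearGroup.coe_mul]
  simp [sW, Matrix.one_fin_two]

lemma gW_gT (k : ZMod 5) : gW * gT k = gT (-k) * gW := by
  refine mk_eq_of (sW * sT ^ k.val) (sT ^ (-k).val * sW) ?_
  have key : ∀ k : ZMod 5, 
    ((2 : ZMod 11) ^ (-k).val = 6 ^ k.val ∧ (6 : ZMod 11) ^ (-k).val = 2 ^ k.val) ∨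
    ((2 : ZMod 11) ^ (-k).val = -6 ^ k.val ∧ (6 : ZMod 11) ^ (-k).val = -2 ^ k.val) := by
    decide
  rcases key k with ⟨h1, h2⟩ | ⟨h1, h2⟩
  · left
    apply Subtype.ext
    simp only [Matrix.SpecialLinearGroup.coe_mul, sT_pow, h1, h2]
    simp [sW]
  · right
    apply Subtype.ext
    simp only [Matrix.SpecialLinearGroup.coe_neg, Matrix.SpecialLinearGroup.coe_mul, sT_pow, h1, h2]
    simp [sW]

def eE : ZMod 11 → ZMod 5 := ![0, 0, 4, 2, 3, 1, 1, 3, 2, 4, 0]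
def nI : ZMod 11 → ZMod 11 := ![0, 10, 5, 7, 8, 2, 9, 3, 4, 6, 1]

set_option maxRecDepth 10000 in
lemma gW_gU_gW (j : ZMod 11) (hj : j ≠ 0) :
    gW * gU j * gW = gU (nI j) * gT (eE j) * gW * gU (nI j) := by
  refine mk_eq_of (sW * sU j * sW) (sU (nI j) * sT ^ (eE j).val * sW * sU (nI j)) ?_
  have key : ∀ j : ZMod 11, j ≠ 0 → (nI j * j = -1 ∧ 2 ^ (eE j).val * 6 ^ (eE j).val = (1 : ZMod 11)) ∧
    ((6 : ZMod 11) ^ (eE j).val = j ∨ (6 : ZMod 11) ^ (eE j).val = -j) := by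
    decide
  obtain ⟨⟨h1, h2⟩, h3⟩ := key j hj
  rcases h3 with h | h
  · have h5 : (2 : ZMod 11) ^ (eE j).val = -nI j := by
      rw [h] at h2
      apply mul_right_cancel₀ hj; linear_combination h2 + h1
    right
    apply Subtype.ext
    simp only [Matrix.SpecialLinearGroup.coe_neg, Matrix.SpecialLinearGroup.coe_mul, sT_pow, h, h5]
    simp only [sW, sU]
    ext a b
    fin_cases a <;> fin_cases b <;> simp <;> first | ring1 | linear_combination h1 | linear_combination -h1 | linear_combination (nI j) * h1 | linear_combination -(nI j) * h1
  · have h5 : (2 : ZMod 11) ^ (eE j).val = nI j := by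
      rw [h] at h2
      apply mul_right_cancel₀ hj; linear_combination -h2 - h1
    left
    apply Subtype.ext
    simp only [Matrix.SpecialLinearGroup.coe_neg, Matrix.SpecialLinearGroup.coe_mul, sT_pow, h, h5]
    simp only [sW, sU]
    ext a b
    fin_cases a <;> fin_cases b <;> simp <;> first | ring1 | linear_combination h1 | linear_combination -h1 | linear_combination (nI j) * h1 | linear_combination -(nI j) * h1

lemma bruhat (g : PSL2F11) : (∃ a k, g = gU a * gT k) ∨ (∃ a k b, g = gU a * gT k * gW * gU b) := by
  have diag : ∀ x : ZMod 11, x ≠ 0 → ∃ k : ZMod 5, 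
     ((2 : ZMod 11) ^ k.val = x ∧ (6 : ZMod 11) ^ k.val = x⁻¹) ∨
     ((2 : ZMod 11) ^ k.val = -x ∧ (6 : ZMod 11) ^ k.val = -x⁻¹) := by
    have key : ∀ x : ZMod 11, x ≠ 0 → ∃ k : ZMod 5, (2 : ZMod 11) ^ k.val * 6 ^ k.val = 1 ∧ 
      ((2 : ZMod 11) ^ k.val = x ∨ (2 : ZMod 11) ^ k.val = -x) := by decide
    intro x hx
    obtain ⟨k, h1, h2⟩ := key x hx
    refine ⟨k, ?_⟩
    rcases h2 with h | h
    · left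
      rw [h] at h1 ⊢
      exact ⟨rfl, eq_inv_of_mul_eq_one_right h1⟩
    · right
      rw [h] at h1 ⊢
      refine ⟨rfl, ?_⟩
      rw [← inv_neg]
      exact eq_inv_of_mul_eq_one_right h1
  obtain ⟨s, rfl⟩ := QuotientGroup.mk_surjective g
  have hdet := s.2
  rw [Matrix.det_fin_two] at hdet
  by_cases hc : s.1 1 0 = 0
  · left
    rw [hc, mul_zero, sub_zero] at hdet
    have ha : s.1 0 0 ≠ 0 := by
      intro h; rw [h] at hdet; simp at hdet
    have hd : s.1 1 1 = (s.1 0 0)⁻¹ := by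
      exact eq_inv_of_mul_eq_one_right hdet
    obtain ⟨k, hk⟩ := diag _ ha
    refine ⟨s.1 0 1 * s.1 0 0, k, mk_eq_of s (sU _ * sT ^ k.val) ?_⟩
    rcases hk with ⟨h1, h2⟩ | ⟨h1, h2⟩
    · left
      apply Subtype.ext
      simp only [Matrix.SpecialLinearGroup.coe_mul, sT_pow, h1, h2]
      ext i j
      fin_cases i <;> fin_cases j <;> simp [sU, hc, hd, ha]
    · right
      apply Subtype.ext
      simp only [Matrix.SpecialLinearGroup.coe_neg, Matrix.SpecialLinearGroup.coe_mul, sT_pow, h1, h2]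
      ext i j
      fin_cases i <;> fin_cases j <;> simp [sU, hc, hd, ha]
  · right
    obtain ⟨k, hk⟩ := diag (-(s.1 1 0)⁻¹) (by simpa using hc)
    refine ⟨s.1 0 0 * (s.1 1 0)⁻¹, k, s.1 1 1 * (s.1 1 0)⁻¹, 
      mk_eq_of s (sU _ * sT ^ k.val * sW * sU _) ?_⟩
    have hb : s.1 0 1 = (s.1 0 0 * s.1 1 1 - 1) * (s.1 1 0)⁻¹ := by
      rw [eq_mul_inv_iff_mul_eq₀ hc]; linear_combination -hdet
    rcases hk with ⟨h1, h2⟩ | ⟨h1, h2⟩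
    · left
      apply Subtype.ext
      simp only [Matrix.SpecialLinearGroup.coe_mul, sT_pow, h1, h2]
      ext i j
      fin_cases i <;> fin_cases j <;> simp [sU, sW, hb] <;> field_simp <;> ring
    · right
      apply Subtype.ext
      simp only [Matrix.SpecialLinearGroup.coe_neg, Matrix.SpecialLinearGroup.coe_mul, sT_pow, h1, h2]
      ext i j
      fin_cases i <;> fin_cases j <;> simp [sU, sW, hb] <;> field_simp <;> ring

/-- Maschke -/
lemma maschke {E : Type*} [AddCommGroup E] [Module ℂ E] (σ : Representation ℂ PSL2F11 E)
    (U S : Submodule ℂ E) (hU : ∀ g, ∀ y ∈ U, σ g y ∈ U) (hS : ∀ g, ∀ y ∈ S, σ g y ∈ S)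
    (hle : U ≤ S) : ∃ U' : Submodule ℂ E, U' ≤ S ∧ (∀ g, ∀ y ∈ U', σ g y ∈ U') ∧
      U ⊓ U' = ⊥ ∧ U ⊔ U' = S := by
  have : Finite PSL2F11 := inferInstance
  have : NeZero (Nat.card PSL2F11 : ℂ) := ⟨Nat.cast_ne_zero.mpr Nat.card_pos.ne'⟩
  have h : Representation.IsSemisimpleRepresentation σ := inferInstance
  obtain ⟨C, hC⟩ := h.exists_isCompl (⟨U, fun g v hv => hU g v hv⟩ : Subrepresentation σ)
  have hinf : U ⊓ C.toSubmodule = ⊥ := by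
    have := congrArg Subrepresentation.toSubmodule hC.inf_eq_bot
    simpa using! this
  have hsup : U ⊔ C.toSubmodule = ⊤ := by
    have := congrArg Subrepresentation.toSubmodule hC.sup_eq_top
    simpa using! this
  refine ⟨C.toSubmodule ⊓ S, inf_le_right, ?_, ?_, ?_⟩
  · intro g y hy
    exact ⟨C.apply_mem_toSubmodule g hy.1, hS g y hy.2⟩
  · rw [← inf_assoc, hinf, bot_inf_eq]
  · rw [← sup_inf_assoc_of_le _ hle, hsup, top_inf_eq]

end P11

namespace P11

section proj
variable {n : ℕ} [NeZero n] {E : Type*} [AddCommGroup E] [Module ℂ E]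

noncomputable def pr (A : ZMod n → E →ₗ[ℂ] E) (χ : AddChar (ZMod n) ℂ) (k : ZMod n) : E →ₗ[ℂ] E :=
  (n : ℂ)⁻¹ • ∑ j, χ (-(j * k)) • A j

lemma pr_apply (A : ZMod n → E →ₗ[ℂ] E) (χ : AddChar (ZMod n) ℂ) (k : ZMod n) (y : E) :
    pr A χ k y = (n : ℂ)⁻¹ • ∑ j, χ (-(j * k)) • A j y := by
  simp [pr]

variable (A : ZMod n → E →ₗ[ℂ] E) (χ : AddChar (ZMod n) ℂ) (hA0 : A 0 = 1)
  (hA : ∀ a b, A (a + b) = A a * A b) (hχ : χ.IsPrimitive)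

lemma pr_mem (S : Submodule ℂ E) (hS : ∀ j, ∀ y ∈ S, A j y ∈ S) (k : ZMod n) (y : E) (hy : y ∈ S) :
    pr A χ k y ∈ S := by
  rw [pr_apply]
  exact S.smul_mem _ (S.sum_mem fun j _ => S.smul_mem _ (hS j y hy))

include hA in
lemma pr_eig (k j : ZMod n) (y : E) : A j (pr A χ k y) = χ (j * k) • pr A χ k y := by
  rw [pr_apply, map_smul, map_sum, smul_comm]
  congr 1
  rw [Finset.smul_sum]
  refine Fintype.sum_equiv (Equiv.addLeft j) _ _ fun i => ?_
  simp only [map_smul, Equiv.coe_addLeft, hA, Module.End.mul_apply, smul_smul]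
  congr 1
  rw [← AddChar.map_add_eq_mul]
  congr 1; ring

include hA in
lemma pr_comp (k j : ZMod n) (y : E) : pr A χ k (A j y) = χ (j * k) • pr A χ k y := by
  rw [pr_apply, pr_apply, smul_comm]
  congr 1
  rw [Finset.smul_sum]
  refine Fintype.sum_equiv (Equiv.addRight j) _ _ fun i => ?_
  simp only [Equiv.coe_addRight, hA, Module.End.mul_apply, smul_smul]
  congr 1
  rw [← AddChar.map_add_eq_mul]
  congr 1; ring

include hA0 hχ in
lemma pr_sum (y : E) : ∑ k, pr A χ k y = y := by
  simp only [pr_apply]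
  rw [← Finset.smul_sum, Finset.sum_comm]
  simp only [← Finset.sum_smul]
  have : ∀ j : ZMod n, ∑ k, χ (-(j * k)) = if j = 0 then (n : ℂ) else 0 := by
    intro j
    have := AddChar.sum_mulShift (-j) hχ
    simp only [neg_eq_zero, ZMod.card] at this
    have h2 : (if j = 0 then (n : ℂ) else 0) = ((if j = 0 then n else 0 : ℕ) : ℂ) := by
      split_ifs <;> simp
    rw [h2, ← this]
    refine Finset.sum_congr rfl fun k _ => ?_
    congr 1; ring
  simp [this, hA0, smul_smul]

include hχ in
lemma pr_of_eig (k l : ZMod n) (y : E) (hy : ∀ j, A j y = χ (j * k) • y) :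
    pr A χ l y = if l = k then y else 0 := by
  simp only [pr_apply, hy, smul_smul, ← AddChar.map_add_eq_mul]
  rw [← Finset.sum_smul, smul_smul]
  have : ∑ j : ZMod n, χ (-(j * l) + j * k) = if l = k then (n : ℂ) else 0 := by
    have := AddChar.sum_mulShift (k - l) hχ
    simp only [sub_eq_zero, ZMod.card] at this
    have h2 : (if l = k then (n : ℂ) else 0) = ((if k = l then n else 0 : ℕ) : ℂ) := by
      by_cases h : l = k
      · simp [h]
      · simp [h, Ne.symm h]
    rw [h2, ← this]
    refine Finset.sum_congr rfl fun k _ => ?_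
    congr 1; ring
  rw [this]
  split_ifs <;> simp
end proj

section rep
variable {E : Type*} [AddCommGroup E] [Module ℂ E] (σ : Representation ℂ PSL2F11 E)
  (χ : AddChar (ZMod 11) ℂ) (ω : AddChar (ZMod 5) ℂ) (hχ : χ.IsPrimitive) (hω : ω.IsPrimitive)

noncomputable abbrev AU (j : ZMod 11) : E →ₗ[ℂ] E := σ (gU j)
noncomputable abbrev AT (j : ZMod 5) : E →ₗ[ℂ] E := σ (gT j)
noncomputable abbrev PU (k : ZMod 11) : E →ₗ[ℂ] E := pr (AU σ) χ k
noncomputable abbrev PT (k : ZMod 5) : E →ₗ[ℂ] E := pr (AT σ) ω k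

lemma AU_zero : AU σ 0 = 1 := by simp [AU, gU_zero]
lemma AU_add (a b) : AU σ (a + b) = AU σ a * AU σ b := by simp [AU, gU_add]
lemma AT_zero : AT σ 0 = 1 := by simp [AT, gT_zero]
lemma AT_add (a b) : AT σ (a + b) = AT σ a * AT σ b := by simp [AT, gT_add]

/-- stability is enough to check on generators -/
lemma stable_of (S : Submodule ℂ E) (hU : ∀ j, ∀ y ∈ S, σ (gU j) y ∈ S)
    (hT : ∀ j, ∀ y ∈ S, σ (gT j) y ∈ S) (hW : ∀ y ∈ S, σ gW y ∈ S) :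
    ∀ g, ∀ y ∈ S, σ g y ∈ S := by
  intro g y hy
  rcases bruhat g with ⟨a, k, rfl⟩ | ⟨a, k, b, rfl⟩
  · simp only [map_mul, Module.End.mul_apply]
    exact hU _ _ (hT _ _ hy)
  · simp only [map_mul, Module.End.mul_apply]
    exact hU _ _ (hT _ _ (hW _ (hU _ _ hy)))

lemma inv_pow (k : ZMod 5) : (4 : ZMod 11) ^ k.val * 3 ^ k.val = 1 := by
  revert k; decide

lemma T_weight (k : ZMod 11) (i : ZMod 5) (y : E) (hy : ∀ j, σ (gU j) y = χ (j * k) • y) (j : ZMod 11) :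
    σ (gU j) (σ (gT i) y) = χ (j * (3 ^ i.val * k)) • σ (gT i) y := by
  have h : gU j * gT i = gT i * gU (3 ^ i.val * j) := by
    rw [gT_gU, ← mul_assoc, inv_pow, one_mul]
  rw [← Module.End.mul_apply, ← map_mul, h, map_mul, Module.End.mul_apply, hy, map_smul]
  congr 2; ring

/-- `v` is a weight-zero vector with torus character `k`. -/
def HW (k : ZMod 5) (v : E) : Prop :=
  (∀ j, σ (gU j) v = v) ∧ (∀ j, σ (gT j) v = ω (j * k) • v)

noncomputable def PI (k : ZMod 5) : E →ₗ[ℂ] E := PT σ ω k ∘ₗ PU σ χ 0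

include hχ hω in
lemma PI_HW (k l : ZMod 5) (v : E) (hv : HW σ ω k v) : PI σ χ ω l v = if l = k then v else 0 := by
  have h1 : PU σ χ 0 v = v := by
    rw [PU, pr_of_eig (AU σ) χ hχ 0 0 v (by simpa using hv.1)]; simp
  rw [PI, LinearMap.comp_apply, h1, PT, pr_of_eig (AT σ) ω hω k l v hv.2]

lemma HW_PI (k : ZMod 5) (y : E) : HW σ ω k (PI σ χ ω k y) := by
  constructor
  · intro j
    have hw : ∀ j, σ (gU j) (PU σ χ 0 y) = χ (j * 0) • PU σ χ 0 y := fun j =>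
      pr_eig (AU σ) χ (AU_add σ) 0 j y
    rw [PI, LinearMap.comp_apply]
    set y' := PU σ χ 0 y
    rw [PT, pr_apply, map_smul, map_sum]
    congr 1
    refine Finset.sum_congr rfl fun i _ => ?_
    rw [map_smul]
    congr 1
    rw [T_weight σ χ 0 i y' hw j]
    simp
  · intro j
    exact pr_eig (AT σ) ω (AT_add σ) k j _

lemma PI_mem (S : Submodule ℂ E) (hS : ∀ g, ∀ y ∈ S, σ g y ∈ S) (k) (y : E) (hy : y ∈ S) :
    PI σ χ ω k y ∈ S := by
  rw [PI, LinearMap.comp_apply]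
  exact pr_mem _ _ S (fun j => hS _) _ _ (pr_mem _ _ S (fun j => hS _) _ _ hy)

noncomputable def vp (v : E) : E := PU σ χ 0 (σ gW v)

lemma T_W (k : ZMod 5) (v : E) (hv : HW σ ω k v) (j) : σ (gT j) (σ gW v) = ω (j * -k) • σ gW v := by
  have : gT j * gW = gW * gT (-j) := by rw [gW_gT, neg_neg]
  rw [← Module.End.mul_apply, ← map_mul, this, map_mul, Module.End.mul_apply, hv.2, map_smul]
  congr 2; ring

lemma four_pow_mul (k : ZMod 5) : Function.Bijective (fun j : ZMod 11 => 4 ^ k.val * j) := by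
  have h : (4 : ZMod 11) ^ k.val ≠ 0 := by
    intro h; have := inv_pow k; rw [h] at this; simp at this
  exact (Equiv.mulLeft₀ _ h).bijective

lemma T_PU0 (j : ZMod 5) (y : E) : σ (gT j) (PU σ χ 0 y) = PU σ χ 0 (σ (gT j) y) := by
  rw [PU, pr_apply, pr_apply, map_smul, map_sum]
  congr 1
  refine Fintype.sum_bijective _ (four_pow_mul j) _ _ fun i => ?_
  rw [map_smul, mul_zero, mul_zero]
  congr 1
  rw [← Module.End.mul_apply, ← map_mul, gT_gU, map_mul, Module.End.mul_apply]

lemma HW_vp (k : ZMod 5) (v : E) (hv : HW σ ω k v) : HW σ ω (-k) (vp σ χ v) := by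
  constructor
  · intro j
    have := pr_eig (AU σ) χ (AU_add σ) 0 j (σ gW v)
    simpa [vp] using this
  · intro j
    rw [vp, T_PU0, T_W σ ω k v hv, map_smul]

/-- the subrepresentation generated by `v` -/
noncomputable def SS (v : E) : Submodule ℂ E :=
  Submodule.span ℂ (insert v (Set.range fun j : ZMod 11 => σ (gU j) (σ gW v)))

lemma mem_SS (v : E) : v ∈ SS σ v := Submodule.subset_span (Set.mem_insert _ _)
lemma mem_SS' (v : E) (j) : σ (gU j) (σ gW v) ∈ SS σ v :=
  Submodule.subset_span (Set.mem_insert_of_mem _ ⟨j, rfl⟩)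

lemma SS_le (v : E) (S : Submodule ℂ E) (hS : ∀ g, ∀ y ∈ S, σ g y ∈ S) (hv : v ∈ S) : SS σ v ≤ S := by
  rw [SS, Submodule.span_le]
  rintro y (rfl | ⟨j, rfl⟩)
  · exact hv
  · exact hS _ _ (hS _ _ hv)

lemma WUW (k : ZMod 5) (v : E) (hv : HW σ ω k v) (j : ZMod 11) (hj : j ≠ 0) :
    σ gW (σ (gU j) (σ gW v)) = ω (eE j * -k) • σ (gU (nI j)) (σ gW v) := by
  rw [← Module.End.mul_apply, ← map_mul, ← Module.End.mul_apply, ← map_mul, gW_gU_gW j hj]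
  simp only [map_mul, Module.End.mul_apply, hv.1]
  rw [T_W σ ω k v hv, map_smul]

lemma WW (v : E) : σ gW (σ gW v) = v := by
  rw [← Module.End.mul_apply, ← map_mul, gW_gW]; simp

lemma SS_stable (k : ZMod 5) (v : E) (hv : HW σ ω k v) : ∀ g, ∀ y ∈ SS σ v, σ g y ∈ SS σ v := by
  have gen : ∀ f : E →ₗ[ℂ] E, f v ∈ SS σ v → (∀ j, f (σ (gU j) (σ gW v)) ∈ SS σ v) → 
      ∀ y ∈ SS σ v, f y ∈ SS σ v := by
    intro f h1 h2 y hy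
    have : SS σ v ≤ (SS σ v).comap f := by
      conv_lhs => rw [SS]
      rw [Submodule.span_le]
      rintro y (rfl | ⟨j, rfl⟩)
      · exact h1
      · exact h2 j
    exact this hy
  refine stable_of σ _ (fun j => gen _ ?_ fun i => ?_) (fun j => gen _ ?_ fun i => ?_) (gen _ ?_ fun i => ?_)
  · rw [hv.1]; exact mem_SS σ v
  · rw [← Module.End.mul_apply, ← map_mul, ← gU_add]; exact mem_SS' σ v _
  · rw [hv.2]; exact Submodule.smul_mem _ _ (mem_SS σ v)
  · rw [← Module.End.mul_apply, ← map_mul, gT_gU, map_mul, Module.End.mul_apply, T_W σ ω k v hv, map_smul]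
    exact Submodule.smul_mem _ _ (mem_SS' σ v _)
  · have := mem_SS' σ v 0
    simpa [gU_zero] using this
  · by_cases hi : i = 0
    · subst hi
      simp only [gU_zero, map_one, Module.End.one_apply, WW]
      exact mem_SS σ v
    · rw [WUW σ ω k v hv i hi]
      exact Submodule.smul_mem _ _ (mem_SS' σ v _)

include hχ hω in
/-- torus projections on the generated representation -/
lemma PI_SS (k l : ZMod 5) (v : E) (hv : HW σ ω k v) (y : E) (hy : y ∈ SS σ v) :
    PI σ χ ω l y ∈ Submodule.span ℂ {w | (w = v ∧ l = k) ∨ (w = vp σ χ v ∧ l = -k)} := by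
  set Q := Submodule.span ℂ {w | (w = v ∧ l = k) ∨ (w = vp σ χ v ∧ l = -k)} with hQ
  have : SS σ v ≤ Q.comap (PI σ χ ω l) := by
    rw [SS, Submodule.span_le]
    rintro y (rfl | ⟨j, rfl⟩)
    · simp only [Submodule.comap_coe, Set.mem_preimage, SetLike.mem_coe]
      rw [PI_HW σ χ ω hχ hω k l y hv]
      split_ifs with h
      · exact Submodule.subset_span (Or.inl ⟨rfl, h⟩)
      · exact Q.zero_mem
    · simp only [Submodule.comap_coe, Set.mem_preimage, SetLike.mem_coe]
      have e : PI σ χ ω l (σ (gU j) (σ gW v)) = PI σ χ ω l (vp σ χ v) := by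
        have h1 : PU σ χ 0 (σ (gU j) (σ gW v)) = vp σ χ v := by
          have := pr_comp (AU σ) χ (AU_add σ) 0 j (σ gW v)
          simpa [vp] using this
        have h2 : PU σ χ 0 (vp σ χ v) = vp σ χ v := by
          rw [PU, pr_of_eig (AU σ) χ hχ 0 0 _ (by simpa using (HW_vp σ χ ω k v hv).1)]; simp
        rw [PI, LinearMap.comp_apply, LinearMap.comp_apply, h1, h2]
      rw [e, PI_HW σ χ ω hχ hω (-k) l _ (HW_vp σ χ ω k v hv)]
      split_ifs with h
      · exact Submodule.subset_span (Or.inr ⟨rfl, h⟩)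
      · exact Q.zero_mem
  exact this hy

include hχ hω in
lemma PI_SS_zero (k l : ZMod 5) (v : E) (hv : HW σ ω k v) (y : E) (hy : y ∈ SS σ v)
    (h1 : l ≠ k) (h2 : l ≠ -k) : PI σ χ ω l y = 0 := by
  have := PI_SS σ χ ω hχ hω k l v hv y hy
  simpa [h1, h2] using this

lemma five_neg (k : ZMod 5) (hk : k ≠ 0) : k ≠ -k := by revert k; decide

include hχ hω in
lemma SS_irred (k : ZMod 5) (hk : k ≠ 0) (v : E) (hv : HW σ ω k v) (hv0 : v ≠ 0)
    (U : Submodule ℂ E) (hU : ∀ g, ∀ y ∈ U, σ g y ∈ U) (hle : U ≤ SS σ v) : U = ⊥ ∨ U = SS σ v := by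
  obtain ⟨U', hle', hU', hinf, hsup⟩ := maschke σ U (SS σ v) hU (SS_stable σ ω k v hv) hle
  have hvm := mem_SS σ v
  rw [← hsup, Submodule.mem_sup] at hvm
  obtain ⟨a, ha, b, hb, hab⟩ := hvm
  have hs : ∀ y ∈ SS σ v, ∃ c : ℂ, c • v = PI σ χ ω k y := by
    intro y hy
    have := PI_SS σ χ ω hχ hω k k v hv y hy
    simp only [five_neg k hk, and_false, or_false, and_true] at this
    rwa [Set.ofPred_eq_eq_singleton, Submodule.mem_span_singleton] at this
  obtain ⟨c, hc⟩ := hs a (hle ha)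
  obtain ⟨d, hd⟩ := hs b (hle' hb)
  have hcd : (c + d) • v = v := by
    rw [add_smul, hc, hd, ← map_add, hab, PI_HW σ χ ω hχ hω k k v hv]; simp
  by_cases h0 : c = 0
  · left
    have hd0 : d ≠ 0 := by
      rintro rfl; rw [h0] at hcd; simp at hcd; exact hv0 hcd.symm
    have : v ∈ U' := by
      have h := PI_mem σ χ ω U' hU' k b hb
      rw [← hd] at h
      exact (Submodule.smul_mem_iff _ hd0).mp h
    have := SS_le σ v U' hU' this
    have h3 : U ≤ U' := hle.trans this
    rw [← hinf]; exact (inf_eq_left.mpr h3).symm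
  · right
    have : v ∈ U := by
      have h := PI_mem σ χ ω U hU k a ha
      rw [← hc] at h
      exact (Submodule.smul_mem_iff _ h0).mp h
    exact le_antisymm hle (SS_le σ v U hU this)

include hχ hω in
lemma PW_ne (k : ZMod 5) (hk : k ≠ 0) (v : E) (hv : HW σ ω k v) (hv0 : v ≠ 0) (l : ZMod 11) :
    PU σ χ l (σ gW v) ≠ 0 := by
  intro h
  have h1 : PI σ χ ω k (σ gW (PU σ χ l (σ gW v))) = (11 : ℂ)⁻¹ • v := by
    rw [PU, pr_apply, map_smul, map_smul, map_sum, map_sum]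
    rw [Finset.sum_eq_single 0]
    · simp only [AU_zero, Module.End.one_apply, WW, map_smul, PI_HW σ χ ω hχ hω k k v hv]
      simp
    · intro j _ hj
      rw [map_smul, map_smul]
      have e : PI σ χ ω k (σ gW ((AU σ j) (σ gW v))) = 0 := by
        change PI σ χ ω k (σ gW (σ (gU j) (σ gW v))) = 0
        rw [WUW σ ω k v hv j hj, map_smul]
        have h1 : PU σ χ 0 (σ (gU (nI j)) (σ gW v)) = vp σ χ v := by
          have := pr_comp (AU σ) χ (AU_add σ) 0 (nI j) (σ gW v)
          simpa [vp] using this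
        have h2 : PU σ χ 0 (vp σ χ v) = vp σ χ v := by
          rw [PU, pr_of_eig (AU σ) χ hχ 0 0 _ (by simpa using (HW_vp σ χ ω k v hv).1)]; simp
        have h3 := PI_HW σ χ ω hχ hω (-k) k _ (HW_vp σ χ ω k v hv)
        rw [if_neg (five_neg k hk), PI, LinearMap.comp_apply, h2] at h3
        rw [PI, LinearMap.comp_apply, h1, h3, smul_zero]
      rw [e, smul_zero]
    · simp
  rw [h, map_zero, map_zero] at h1
  have := h1.symm
  rw [smul_eq_zero] at this
  rcases this with h | h
  · norm_num at h
  · exact hv0 h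

include hχ hω in
lemma SS_finrank (k : ZMod 5) (hk : k ≠ 0) (v : E) (hv : HW σ ω k v) (hv0 : v ≠ 0) :
    Module.finrank ℂ (SS σ v) = 12 := by
  let b : Option (ZMod 11) → E := fun o => o.elim v (fun l => PU σ χ l (σ gW v))
  have hspan : SS σ v = Submodule.span ℂ (Set.range b) := by
    apply le_antisymm
    · rw [SS, Submodule.span_le]
      rintro y (rfl | ⟨j, rfl⟩)
      · exact Submodule.subset_span ⟨none, rfl⟩
      · change σ (gU j) (σ gW v) ∈ _
        rw [← pr_sum (AU σ) χ (AU_zero σ) hχ (σ (gU j) (σ gW v))]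
        refine Submodule.sum_mem _ fun l _ => ?_
        have := pr_comp (AU σ) χ (AU_add σ) l j (σ gW v)
        change pr (AU σ) χ l (AU σ j (σ gW v)) ∈ _
        rw [this]
        exact Submodule.smul_mem _ _ (Submodule.subset_span ⟨some l, rfl⟩)
    · rw [Submodule.span_le]
      rintro y ⟨o, rfl⟩
      cases o with
      | none => exact mem_SS σ v
      | some l =>
        have hst := SS_stable σ ω k v hv
        exact pr_mem _ _ _ (fun j => hst _) _ _ (hst _ _ (mem_SS σ v))
  have hli : LinearIndependent ℂ b := by
    rw [Fintype.linearIndependent_iff]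
    intro g hg
    rw [Fintype.sum_option] at hg
    have hpl : ∀ l m, PU σ χ l (PU σ χ m (σ gW v)) = if l = m then PU σ χ m (σ gW v) else 0 := fun l m =>
      pr_of_eig (AU σ) χ hχ m l _ (fun j => pr_eig (AU σ) χ (AU_add σ) m j _)
    have hpv : ∀ l, PU σ χ l v = if l = 0 then v else 0 := fun l =>
      pr_of_eig (AU σ) χ hχ 0 l v (by simpa using hv.1)
    have key : ∀ l, g none • PU σ χ l v + g (some l) • PU σ χ l (σ gW v) = 0 := by
      intro l
      have := congrArg (PU σ χ l) hg
      simp only [map_add, map_sum, map_smul, map_zero, b, Option.elim, hpl] at this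
      simpa using this
    have hn : g none = 0 := by
      have h := congrArg (PI σ χ ω k) (key 0)
      rw [hpv] at h
      change PI σ χ ω k (g none • (if (0 : ZMod 11) = 0 then v else 0) + g (some 0) • vp σ χ v) = _ at h
      rw [if_pos rfl, map_add, map_smul, map_smul, PI_HW σ χ ω hχ hω k k v hv,
        PI_HW σ χ ω hχ hω (-k) k _ (HW_vp σ χ ω k v hv), if_neg (five_neg k hk)] at h
      simpa [hv0] using h
    intro o
    cases o with
    | none => exact hn
    | some l =>
      have := key l
      rw [hn, zero_smul, zero_add, smul_eq_zero] at this
      exact this.resolve_right (PW_ne σ χ ω hχ hω k hk v hv hv0 l)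
  rw [hspan, finrank_span_eq_card hli]
  simp [ZMod.card]

end rep
end P11

namespace P11
section
variable {V : Type} [AddCommGroup V] [Module ℂ V] [FiniteDimensional ℂ V]
    (ρ : Representation ℂ PSL2F11 V)

lemma eE_surj (k : ZMod 5) : ∃ j : ZMod 11, j ≠ 0 ∧ eE j = k := by revert k; decide

lemma exists_weight (χ : AddChar (ZMod 11) ℂ) (hχ : χ.IsPrimitive)
    (hdim : Module.finrank ℂ V = 5)
    (hirr : ∀ W : Submodule ℂ V,
      (∀ g : PSL2F11, ∀ v ∈ W, ρ g v ∈ W) → W = ⊥ ∨ W = ⊤) :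
    ∃ k ≠ 0, ∃ y, PU ρ χ k y ≠ 0 := by
  by_contra! hcon
  have hU : ∀ j, ρ (gU j) = 1 := by
    intro j
    ext y
    have h := pr_sum (AU ρ) χ (AU_zero ρ) hχ y
    rw [Finset.sum_eq_single 0 (fun k _ hk => hcon k hk y) (by simp)] at h
    have h2 := pr_eig (AU ρ) χ (AU_add ρ) 0 j y
    rw [h] at h2
    simpa using h2
  have hW : ρ gW = 1 := by
    have h := congrArg ρ (gW_gU_gW 1 (by decide))
    have h0 : eE 1 = 0 := by decide
    simp only [map_mul, hU, h0, gT_zero, map_one, mul_one, one_mul] at h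
    rw [← map_mul, gW_gW, map_one] at h
    exact h.symm
  have hT : ∀ k, ρ (gT k) = 1 := by
    intro k
    obtain ⟨j, hj, rfl⟩ := eE_surj k
    have h := congrArg ρ (gW_gU_gW j hj)
    simpa only [map_mul, hU, hW, map_one, mul_one, one_mul, eq_comm] using h
  have hall : ∀ g, ρ g = 1 := by
    intro g
    rcases bruhat g with ⟨a, k, rfl⟩ | ⟨a, k, b, rfl⟩ <;> simp [hU, hT, hW]
  have hnt : Nontrivial V := Module.nontrivial_of_finrank_pos (R := ℂ) (by omega)
  obtain ⟨v, hv⟩ := exists_ne (0 : V)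
  have h1 := finrank_span_singleton (K := ℂ) hv
  rcases hirr (Submodule.span ℂ {v}) (by intro g w hw; simpa [hall] using hw) with h | h
  · rw [h] at h1; simp at h1
  · rw [h, finrank_top] at h1; omega

lemma three_inj (i l : ZMod 5) (h : (3 : ZMod 11) ^ i.val = 3 ^ l.val) : i = l := by
  revert i l; decide

lemma V_basis0 
    (hdim : Module.finrank ℂ V = 5)
    (hirr : ∀ W : Submodule ℂ V,
      (∀ g : PSL2F11, ∀ v ∈ W, ρ g v ∈ W) → W = ⊥ ∨ W = ⊤) :
    ∃ χ : AddChar (ZMod 11) ℂ, χ.IsPrimitive ∧ ∃ x : Module.Basis (ZMod 5) ℂ V,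
      (∀ i j, ρ (gU j) (x i) = χ (j * 3 ^ i.val) • x i) ∧
      (∀ i j, ρ (gT j) (x i) = x (i + j)) ∧
      ∃ c : ZMod 5 → ℂ, ∀ i, ρ gW (x i) = ∑ k, c (k + i) • x k := by
  have hχ0 : (ZMod.stdAddChar : AddChar (ZMod 11) ℂ).IsPrimitive := ZMod.isPrimitive_stdAddChar 11
  obtain ⟨k, hk, y, hy⟩ := exists_weight ρ _ hχ0 hdim hirr
  set χ0 : AddChar (ZMod 11) ℂ := ZMod.stdAddChar
  set y0 := PU ρ χ0 k y with hy0
  have hχ : (χ0.mulShift k).IsPrimitive := AddChar.IsPrimitive.of_ne_one (hχ0 hk)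
  have hw0 : ∀ j, ρ (gU j) y0 = (χ0.mulShift k) (j * 1) • y0 := by
    intro j
    rw [AddChar.mulShift_apply, mul_one, mul_comm]
    exact pr_eig (AU ρ) χ0 (AU_add ρ) k j y
  set χ := χ0.mulShift k
  have hw : ∀ i j, ρ (gU j) (ρ (gT i) y0) = χ (j * 3 ^ i.val) • ρ (gT i) y0 := by
    intro i j
    have := T_weight ρ χ 1 i y0 hw0 j
    simpa using this
  have hne : ∀ i, ρ (gT i) y0 ≠ 0 := by
    intro i h
    have h2 : ρ (gT (-i)) (ρ (gT i) y0) = y0 := by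
      rw [← Module.End.mul_apply, ← map_mul, ← gT_add]; simp [gT_zero]
    rw [h, map_zero] at h2
    exact hy h2.symm
  have hli : LinearIndependent ℂ (fun i : ZMod 5 => ρ (gT i) y0) := by
    rw [Fintype.linearIndependent_iff]
    intro g hg l
    have h := congrArg (PU ρ χ (3 ^ l.val)) hg
    rw [map_sum, map_zero, Finset.sum_eq_single l] at h
    · rw [map_smul, PU, pr_of_eig (AU ρ) χ hχ _ _ _ (hw l), if_pos rfl, smul_eq_zero] at h
      exact h.resolve_right (hne l)
    · intro i _ hi
      rw [map_smul, PU, pr_of_eig (AU ρ) χ hχ _ _ _ (hw i), if_neg, smul_zero]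
      intro h; exact hi (three_inj l i h).symm
    · simp
  let x := basisOfLinearIndependentOfCardEqFinrank hli (by simp [hdim, ZMod.card])
  have hx : ∀ i, x i = ρ (gT i) y0 := fun i => by simp [x]
  have hxT : ∀ i j, ρ (gT j) (x i) = x (i + j) := by
    intro i j
    rw [hx, hx, ← Module.End.mul_apply, ← map_mul, ← gT_add, add_comm]
  refine ⟨χ, hχ, x, fun i j => by rw [hx]; exact hw i j, hxT, x.repr (ρ gW (x 0)), fun i => ?_⟩
  have e : x i = ρ (gT i) (x 0) := by rw [hxT, zero_add]
  have h1 : ρ gW (x i) = ρ (gT (-i)) (ρ gW (x 0)) := by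
    rw [e, ← Module.End.mul_apply, ← map_mul, gW_gT, map_mul, Module.End.mul_apply]
  rw [h1]
  conv_lhs => rw [← x.sum_repr (ρ gW (x 0)), map_sum]
  refine Fintype.sum_equiv (Equiv.addRight (-i)) _ _ fun k => ?_
  rw [map_smul, hxT]
  simp
end
end P11

namespace P11
noncomputable def gam {F : Type*} [Field F] (ζ : F) : F := (1+2*(ζ+ζ^3+ζ^4+ζ^5+ζ^9))/11
set_option maxHeartbeats 4000000 in
lemma cval {F : Type*} [Field F] [CharZero F] (ζ s : F) (c : ZMod 5 → F) (hs : s = ζ+ζ^3+ζ^4+ζ^5+ζ^9) (hΦ : 1+ζ+ζ^2+ζ^3+ζ^4+ζ^5+ζ^6+ζ^7+ζ^8+ζ^9+ζ^10=0)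
  (q0 : (-1) + (-1-s)*(ζ^10*ζ^10*c 0) + (ζ^5*ζ^5*c 1) + (-1)*(ζ^7*ζ^7*c 3) + (-s)*(ζ^8*ζ^8*c 2) + (ζ^2*ζ^2*c 4) = 0)
  (q1 : 0 + (-1-s)*(ζ^10*ζ^8*c 1) + (ζ^5*ζ^4*c 2) + (-1)*(ζ^7*ζ^10*c 4) + (-s)*(ζ^8*ζ^2*c 3) + (ζ^2*ζ^6*c 0) = 0)
  (q2 : 0 + (-1-s)*(ζ^10*ζ^2*c 2) + (ζ^5*ζ^1*c 3) + (-1)*(ζ^7*ζ^8*c 0) + (-s)*(ζ^8*ζ^6*c 4) + (ζ^2*ζ^7*c 1) = 0)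
  (q3 : 0 + (-1-s)*(ζ^10*ζ^6*c 3) + (ζ^5*ζ^3*c 4) + (-1)*(ζ^7*ζ^2*c 1) + (-s)*(ζ^8*ζ^7*c 0) + (ζ^2*ζ^10*c 2) = 0)
  (q4 : 0 + (-1-s)*(ζ^10*ζ^7*c 4) + (ζ^5*ζ^9*c 0) + (-1)*(ζ^7*ζ^6*c 2) + (-s)*(ζ^8*ζ^10*c 1) + (ζ^2*ζ^8*c 3) = 0) :
    c 0 = gam ζ * (ζ^2 - ζ^9) ∧
    c 1 = gam ζ * (ζ^10 - ζ^1) ∧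
    c 2 = gam ζ * (ζ^6 - ζ^5) ∧
    c 3 = gam ζ * (ζ^8 - ζ^3) ∧
    c 4 = gam ζ * (ζ^7 - ζ^4) := by
  subst hs
  unfold gam
  refine ⟨?_, ?_, ?_, ?_, ?_⟩
  · linear_combination ((4/11) + (1/11)*ζ^2 + (2/11)*ζ^3 + (2/11)*ζ^4 + (4/11)*ζ^5 + (4/11)*ζ^6 + (2/11)*ζ^7 + (2/11)*ζ^8 + (1/11)*ζ^9)*q0 + ((-438/16951) + (15406/16951)*ζ + (9087/16951)*ζ^2 + (2696/16951)*ζ^3 + (19350/16951)*ζ^4 + (17269/16951)*ζ^5 + (-8716/16951)*ζ^6 + (282/16951)*ζ^7 + (24481/16951)*ζ^8 + (13929/16951)*ζ^9)*q1 + ((2573/1541) + (30116/16951)*ζ + (3171/16951)*ζ^2 + (4759/16951)*ζ^3 + (23976/16951)*ζ^4 + (19453/16951)*ζ^5 + (7587/16951)*ζ^6 + (22028/16951)*ζ^7 + (23336/16951)*ζ^8 + (1314/16951)*ζ^9)*q2 + ((22489/16951) + (27058/16951)*ζ + (-2106/16951)*ζ^2 + (4864/16951)*ζ^3 + (28208/16951)*ζ^4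 + (23307/16951)*ζ^5 + (-953/16951)*ζ^6 + (13837/16951)*ζ^7 + (27736/16951)*ζ^8 + (7118/16951)*ζ^9)*q3 + ((-4208/16951) + (-16756/16951)*ζ + (-3153/16951)*ζ^2 + (-5470/16951)*ζ^3 + (-1960/1541)*ζ^4 + (-8501/16951)*ζ^5 + (10242/16951)*ζ^6 + (-7014/16951)*ζ^7 + (-20664/16951)*ζ^8 + (-10630/16951)*ζ^9)*q4 - (((-1) + ζ + (-438/16951)*ζ^8 + (15844/16951)*ζ^9 + (-6319/16951)*ζ^10 + (-2122/1541)*ζ^11 + (3055/1541)*ζ^12 + (-2081/16951)*ζ^13 + (-30193/16951)*ζ^14 + (-31853/16951)*ζ^15 + (13500/16951)*ζ^16 + (9507/16951)*ζ^17 + (-1084/737)*ζ^18 + (-40624/16951)*ζ^19 + (11708/16951)*ζ^20 + (10817/16951)*ζ^21 + (-23700/16951)*ζ^22 + (-7118/16951)*ζ^23 + (-1/11)*ζ^24 + (-2/11)*ζ^25 + (-1/11)*ζ^27 + (-1/11)*ζ^28)*c 0 + ((5814/16951)*ζ^9 + (3408/16951)*ζ^10 + (-3945/16951)*ζ^11 +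 (-167/737)*ζ^12 + (-2586/16951)*ζ^13 + (378/16951)*ζ^14 + (15476/16951)*ζ^15 + (-349/16951)*ζ^16 + (-15673/16951)*ζ^17 + (-42/737)*ζ^18 + (-6935/16951)*ζ^19 + (7296/16951)*ζ^20 + (651/1541)*ζ^21 + (-10541/16951)*ζ^22 + (-8258/16951)*ζ^23 + (959/1541)*ζ^24 + (-518/16951)*ζ^25 + (-3299/16951)*ζ^26)*c 1 + ((-438/16951)*ζ^9 + (15844/16951)*ζ^10 + (-6319/16951)*ζ^11 + (-12205/16951)*ζ^12 + (-4685/16951)*ζ^13 + (585/1541)*ζ^14 + (-35564/16951)*ζ^15 + (-16262/16951)*ζ^16 + (11359/16951)*ζ^17 + (-1774/16951)*ζ^18 + (-2002/1541)*ζ^19 + (-2855/16951)*ζ^20 + (-2/11)*ζ^21 + (-1/11)*ζ^23 + (-1/11)*ζ^24)*c 2 + ((2573/1541)*ζ^6 + (1813/16951)*ζ^7 + (-26945/16951)*ζ^8 + (1588/16951)*ζ^9 + (15009/16951)*ζ^10 + (-16633/16951)*ζ^11 + (-14107/16951)*ζ^12 + (18881/16951)*ζ^13 + (-29961/16951)*ζ^14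 + (-28540/16951)*ζ^15 + (-7654/16951)*ζ^16 + (67/253)*ζ^17 + (-6/23)*ζ^18 + (-129/67)*ζ^19 + (-31378/16951)*ζ^20 + (14790/16951)*ζ^21 + (13899/16951)*ζ^22 + (-20618/16951)*ζ^23 + (-7118/16951)*ζ^24)*c 3 + ((4/11)*ζ^4 + (-4/11)*ζ^5 + (1/11)*ζ^6 + (1/11)*ζ^7 + (22489/16951)*ζ^8 + (7651/16951)*ζ^9 + (-1268/737)*ζ^10 + (3888/16951)*ζ^11 + (23344/16951)*ζ^12 + (-6442/16951)*ζ^13 + (-25801/16951)*ζ^14 + (-7349/16951)*ζ^15 + (5922/16951)*ζ^16 + (-15789/16951)*ζ^17 + (-36369/16951)*ζ^18 + (5365/16951)*ζ^19 + (35031/16951)*ζ^20 + (7351/16951)*ζ^21 + (-18570/16951)*ζ^22 + (-13650/16951)*ζ^23 + (10034/16951)*ζ^24 + (10630/16951)*ζ^25)*c 4 + ((-4/11) + (4/11)*ζ + (-2/11)*ζ^4 + (2/11)*ζ^7 + (-2/11)*ζ^8)) * hΦ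
  · linear_combination ((3/11) + (1/11)*ζ^2 + (3/11)*ζ^3 + (1/11)*ζ^4 + (-1/11)*ζ^5 + (-1/11)*ζ^6 + (1/11)*ζ^7 + (3/11)*ζ^8 + (1/11)*ζ^9)*q0 + ((18289/16951) + (4325/16951)*ζ + (-17373/16951)*ζ^2 + (-5441/16951)*ζ^3 + (25664/16951)*ζ^4 + (10559/16951)*ζ^5 + (-17465/16951)*ζ^6 + (308/1541)*ζ^7 + (17548/16951)*ζ^8 + (-7858/16951)*ζ^9)*q1 + ((21289/16951) + (-1327/16951)*ζ + (-4927/16951)*ζ^2 + (18842/16951)*ζ^3 + (14866/16951)*ζ^4 + (-19023/16951)*ζ^5 + (-8925/16951)*ζ^6 + (29468/16951)*ζ^7 + (14555/16951)*ζ^8 + (-15538/16951)*ζ^9)*q2 + ((30212/16951) + (2873/16951)*ζ + (-20887/16951)*ζ^2 + (14303/16951)*ζ^3 + (832/737)*ζ^4 + (-11089/16951)*ζ^5 + (-10129/16951)*ζ^6 + (2311/1541)*ζ^7 + (13050/16951)*ζ^8 + (-18439/16951)*ζ^9)*q3 + ((-10522/16951) + (8732/16951)*ζ + (30589/16951)*ζ^2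 + (6009/16951)*ζ^3 + (-16444/16951)*ζ^4 + (9507/16951)*ζ^5 + (19865/16951)*ζ^6 + (-680/16951)*ζ^7 + (3810/16951)*ζ^8 + (23120/16951)*ζ^9)*q4 - (((18289/16951)*ζ^8 + (-13964/16951)*ζ^9 + (-21698/16951)*ζ^10 + (11932/16951)*ζ^11 + (31105/16951)*ζ^12 + (-15105/16951)*ζ^13 + (-38546/16951)*ζ^14 + (18818/16951)*ζ^15 + (28421/16951)*ζ^16 + (-19047/16951)*ζ^17 + (-44816/16951)*ζ^18 + (923/1541)*ζ^19 + (41714/16951)*ζ^20 + (-6207/16951)*ζ^21 + (-36112/16951)*ζ^22 + (10734/16951)*ζ^23 + (-1/11)*ζ^24 + (2/11)*ζ^25 + (2/11)*ζ^26 + (-2/11)*ζ^27 + (-1/11)*ζ^28)*c 0 + ((-1) + ζ + (-8923/16951)*ζ^9 + (9346/16951)*ζ^10 + (-1414/16951)*ζ^11 + (7071/16951)*ζ^12 + (-249/737)*ζ^13 + (-6746/16951)*ζ^14 + (6056/16951)*ζ^15 + (2843/16951)*ζ^16 + (540/16951)*ζ^17 + (-13811/16951)*ζ^18 + (214/16951)*ζ^19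 + (5944/16951)*ζ^20 + (-10512/16951)*ζ^21 + (-32928/16951)*ζ^22 + (28/1541)*ζ^23 + (18650/16951)*ζ^24 + (-6096/16951)*ζ^25 + (-15262/16951)*ζ^26)*c 1 + ((18289/16951)*ζ^9 + (-13964/16951)*ζ^10 + (-21698/16951)*ζ^11 + (20855/16951)*ζ^12 + (15615/16951)*ζ^13 + (-31903/16951)*ζ^14 + (-56149/16951)*ζ^15 + (31800/16951)*ζ^16 + (44557/16951)*ζ^17 + (-1776/1541)*ζ^18 + (-37798/16951)*ζ^19 + (13997/16951)*ζ^20 + (2/11)*ζ^21 + (2/11)*ζ^22 + (-2/11)*ζ^23 + (-1/11)*ζ^24)*c 2 + ((21289/16951)*ζ^6 + (-2056/1541)*ζ^7 + (-3600/16951)*ζ^8 + (23769/16951)*ζ^9 + (-1318/1541)*ζ^10 + (-32924/16951)*ζ^11 + (45919/16951)*ζ^12 + (17222/16951)*ζ^13 + (-58246/16951)*ζ^14 + (-13251/16951)*ζ^15 + (2998/1541)*ζ^16 + (2/23)*ζ^17 + (-190/253)*ζ^18 + (-43275/16951)*ζ^19 + (19399/16951)*ζ^20 + (35550/16951)*ζ^21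 + (-12371/16951)*ζ^22 + (-31489/16951)*ζ^23 + (18439/16951)*ζ^24)*c 3 + ((3/11)*ζ^4 + (-3/11)*ζ^5 + (1/11)*ζ^6 + (2/11)*ζ^7 + (27130/16951)*ζ^8 + (-30421/16951)*ζ^9 + (-2160/1541)*ζ^10 + (1664/737)*ζ^11 + (7915/16951)*ζ^12 + (-33307/16951)*ζ^13 + (-581/16951)*ζ^14 + (18884/16951)*ζ^15 + (5622/16951)*ζ^16 + (-55404/16951)*ζ^17 + (4311/16951)*ζ^18 + (16620/16951)*ζ^19 + (7228/16951)*ζ^20 + (-42855/16951)*ζ^21 + (-5007/16951)*ζ^22 + (4490/16951)*ζ^23 + (19310/16951)*ζ^24 + (-23120/16951)*ζ^25)*c 4 + ((-3/11) + (2/11)*ζ + (-2/11)*ζ^2 + (2/11)*ζ^5 + (-2/11)*ζ^8 + (2/11)*ζ^9)) * hΦ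
  · linear_combination ((2/11) + (-2/11)*ζ^3 + (2/11)*ζ^4 + (-1/11)*ζ^5 + (-1/11)*ζ^6 + (2/11)*ζ^7 + (-2/11)*ζ^8)*q0 + ((8570/16951) + (16794/16951)*ζ + (-4214/16951)*ζ^2 + (-7211/16951)*ζ^3 + (1152/1541)*ζ^4 + (419/1541)*ζ^5 + (6498/16951)*ζ^6 + (784/16951)*ζ^7 + (1590/16951)*ζ^8 + (5437/16951)*ζ^9)*q1 + ((9463/16951) + (9151/16951)*ζ + (26/16951)*ζ^2 + (16527/16951)*ζ^3 + (15855/16951)*ζ^4 + (-1995/16951)*ζ^5 + (-130/737)*ζ^6 + (10684/16951)*ζ^7 + (14922/16951)*ζ^8 + (830/1541)*ζ^9)*q2 + ((6015/16951) + (11366/16951)*ζ + (-2830/16951)*ζ^2 + (2374/16951)*ζ^3 + (9168/16951)*ζ^4 + (-772/16951)*ζ^5 + (-6200/16951)*ζ^6 + (8325/16951)*ζ^7 + (11211/16951)*ζ^8 + (-4062/16951)*ζ^9)*q3 + ((-1420/1541) + (-15545/16951)*ζ + (7481/16951)*ζ^2 + (-4753/16951)*ζ^3 + (-10606/16951)*ζ^4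 + (-4644/16951)*ζ^5 + (-10688/16951)*ζ^6 + (-2911/16951)*ζ^7 + (-9139/16951)*ζ^8 + (-5680/16951)*ζ^9)*q4 - (((8570/16951)*ζ^8 + (8224/16951)*ζ^9 + (-21008/16951)*ζ^10 + (-2997/16951)*ζ^11 + (19883/16951)*ζ^12 + (-733/1541)*ζ^13 + (-597/737)*ζ^14 + (-15102/16951)*ζ^15 + (18129/16951)*ζ^16 + (-4613/16951)*ζ^17 + (-19610/16951)*ζ^18 + (-1366/16951)*ζ^19 + (12984/16951)*ζ^20 + (1345/16951)*ζ^21 + (-12191/16951)*ζ^22 + (2521/16951)*ζ^23 + (3/11)*ζ^25 + (-4/11)*ζ^26 + (2/11)*ζ^27)*c 0 + ((3448/16951)*ζ^9 + (-2581/16951)*ζ^10 + (1989/16951)*ζ^11 + (1027/1541)*ζ^12 + (-10548/16951)*ζ^13 + (-1746/16951)*ζ^14 + (-190/16951)*ζ^15 + (-37/737)*ζ^16 + (5975/16951)*ζ^17 + (-5253/16951)*ζ^18 + (-11284/16951)*ζ^19 + (16157/16951)*ζ^20 + (5448/16951)*ζ^21 + (-3912/16951)*ζ^22 + (2063/16951)*ζ^23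 + (-5422/16951)*ζ^24 + (7306/16951)*ζ^25 + (243/16951)*ζ^26)*c 1 + ((-1) + ζ + (8570/16951)*ζ^9 + (8224/16951)*ζ^10 + (-37959/16951)*ζ^11 + (10506/16951)*ζ^12 + (31703/16951)*ζ^13 + (-12897/16951)*ζ^14 + (-32772/16951)*ζ^15 + (-11666/16951)*ζ^16 + (1103/1541)*ζ^17 + (7320/16951)*ζ^18 + (-7333/16951)*ζ^19 + (-830/1541)*ζ^20 + (3/11)*ζ^21 + (-4/11)*ζ^22 + (2/11)*ζ^23)*c 2 + ((9463/16951)*ζ^6 + (-312/16951)*ζ^7 + (-9125/16951)*ζ^8 + (16501/16951)*ζ^9 + (-16292/16951)*ζ^10 + (-2395/1541)*ζ^11 + (13807/16951)*ζ^12 + (13878/16951)*ζ^13 + (-18494/16951)*ζ^14 + (-12417/16951)*ζ^15 + (2655/16951)*ζ^16 + (167/253)*ζ^17 + (-104/253)*ζ^18 + (-21151/16951)*ζ^19 + (-1366/16951)*ζ^20 + (14525/16951)*ζ^21 + (2886/16951)*ζ^22 + (-15273/16951)*ζ^23 + (4062/16951)*ζ^24)*c 3 + ((2/11)*ζ^4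 + (-2/11)*ζ^5 + (-2/11)*ζ^7 + (12179/16951)*ζ^8 + (728/16951)*ζ^9 + (-14196/16951)*ζ^10 + (9827/16951)*ζ^11 + (630/16951)*ζ^12 + (-6858/16951)*ζ^13 + (-236/737)*ζ^14 + (8144/16951)*ζ^15 + (116/16951)*ζ^16 + (-8561/16951)*ζ^17 + (-17351/16951)*ζ^18 + (10732/16951)*ζ^19 + (19339/16951)*ζ^20 + (-6156/16951)*ζ^21 + (-123/1541)*ζ^22 + (-6228/16951)*ζ^23 + (3459/16951)*ζ^24 + (5680/16951)*ζ^25)*c 4 + ((-2/11) + (2/11)*ζ + (2/11)*ζ^3 + (-4/11)*ζ^4 + (2/11)*ζ^5)) * hΦ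
  · linear_combination ((2/11) + (2/11)*ζ^2 + (-1/11)*ζ^3 + (-2/11)*ζ^4 + (-2/11)*ζ^7 + (-1/11)*ζ^8 + (2/11)*ζ^9)*q0 + ((-35628/16951) + (-31384/16951)*ζ + (830/16951)*ζ^2 + (-22266/16951)*ζ^3 + (-39554/16951)*ζ^4 + (-12916/16951)*ζ^5 + (-846/16951)*ζ^6 + (-30454/16951)*ζ^7 + (-35998/16951)*ζ^8 + (-14655/16951)*ζ^9)*q1 + ((-23582/16951) + (6797/16951)*ζ + (23336/16951)*ζ^2 + (-15731/16951)*ζ^3 + (-18093/16951)*ζ^4 + (1714/1541)*ζ^5 + (5070/16951)*ζ^6 + (-17927/16951)*ζ^7 + (-3143/16951)*ζ^8 + (25948/16951)*ζ^9)*q2 + ((-31048/16951) + (64/16951)*ζ + (17016/16951)*ζ^2 + (-17073/16951)*ζ^3 + (-31885/16951)*ζ^4 + (12399/16951)*ζ^5 + (7399/16951)*ζ^6 + (-27694/16951)*ζ^7 + (-15022/16951)*ζ^8 + (1874/1541)*ζ^9)*q3 + ((34462/16951) + (855/1541)*ζ + (-8135/16951)*ζ^2 + (23350/16951)*ζ^3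 + (25625/16951)*ζ^4 + (-2289/16951)*ζ^5 + (-934/16951)*ζ^6 + (22458/16951)*ζ^7 + (22785/16951)*ζ^8 + (697/16951)*ζ^9)*q4 - (((-35628/16951)*ζ^8 + (4244/16951)*ζ^9 + (32214/16951)*ζ^10 + (-23096/16951)*ζ^11 + (-17288/16951)*ζ^12 + (26638/16951)*ζ^13 + (46532/16951)*ζ^14 + (-31083/16951)*ζ^15 + (-22415/16951)*ζ^16 + (5177/16951)*ζ^17 + (70093/16951)*ζ^18 + (-27155/16951)*ζ^19 + (-36634/16951)*ζ^20 + (11131/16951)*ζ^21 + (37177/16951)*ζ^22 + (-15991/16951)*ζ^23 + (-2/11)*ζ^24 + (-2/11)*ζ^25 + (1/11)*ζ^26 + (3/11)*ζ^27 + (-2/11)*ζ^28)*c 0 + ((7466/16951)*ζ^9 + (2349/16951)*ζ^10 + (-3495/16951)*ζ^11 + (-1896/16951)*ζ^12 + (7827/16951)*ζ^13 + (-386/737)*ζ^14 + (-5702/16951)*ζ^15 + (12096/16951)*ζ^16 + (-970/16951)*ζ^17 + (2784/1541)*ζ^18 + (-3789/16951)*ζ^19 + (-7017/16951)*ζ^20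 + (519/737)*ζ^21 + (27383/16951)*ζ^22 + (-6216/16951)*ζ^23 + (-5217/16951)*ζ^24 + (-745/16951)*ζ^25 + (13958/16951)*ζ^26)*c 1 + ((-35628/16951)*ζ^9 + (4244/16951)*ζ^10 + (32214/16951)*ζ^11 + (-30562/16951)*ζ^12 + (-27435/16951)*ζ^13 + (21729/16951)*ζ^14 + (41631/16951)*ζ^15 + (-41273/16951)*ζ^16 + (-24538/16951)*ζ^17 + (16325/16951)*ζ^18 + (33714/16951)*ζ^19 + (-29030/16951)*ζ^20 + (-2/11)*ζ^21 + (1/11)*ζ^22 + (3/11)*ζ^23 + (-2/11)*ζ^24)*c 2 + ((-1) + ζ + (-23582/16951)*ζ^6 + (30379/16951)*ζ^7 + (16539/16951)*ζ^8 + (-39067/16951)*ζ^9 + (32100/16951)*ζ^10 + (1329/737)*ζ^11 + (-18617/16951)*ζ^12 + (1082/1541)*ζ^13 + (68457/16951)*ζ^14 + (20717/16951)*ζ^15 + (-36627/16951)*ζ^16 + (7/253)*ζ^17 + (411/253)*ζ^18 + (59306/16951)*ζ^19 + (-25614/16951)*ζ^20 + (-35093/16951)*ζ^21 + (1152/1541)*ζ^22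 + (35636/16951)*ζ^23 + (-1874/1541)*ζ^24)*c 3 + ((2/11)*ζ^4 + (-2/11)*ζ^5 + (2/11)*ζ^6 + (-3/11)*ζ^7 + (-32589/16951)*ζ^8 + (34194/16951)*ζ^9 + (16952/16951)*ζ^10 + (-37171/16951)*ζ^11 + (-577/737)*ζ^12 + (48907/16951)*ζ^13 + (-8082/16951)*ζ^14 + (-8429/16951)*ζ^15 + (-20789/16951)*ζ^16 + (46927/16951)*ζ^17 + (-6616/16951)*ζ^18 + (-43180/16951)*ζ^19 + (-3265/1541)*ζ^20 + (29749/16951)*ζ^21 + (-2556/16951)*ζ^22 + (327/16951)*ζ^23 + (-2008/1541)*ζ^24 + (-697/16951)*ζ^25)*c 4 + ((-2/11) + (2/11)*ζ + (-2/11)*ζ^2 + (2/11)*ζ^3 + (-2/11)*ζ^6 + (2/11)*ζ^7)) * hΦ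
  · linear_combination ((-4/11)*ζ^2 + (-2/11)*ζ^3 + (-3/11)*ζ^4 + (-2/11)*ζ^5 + (-2/11)*ζ^6 + (-3/11)*ζ^7 + (-2/11)*ζ^8 + (-4/11)*ζ^9)*q0 + ((1709/1541) + (25978/16951)*ζ + (13991/16951)*ζ^2 + (11663/16951)*ζ^3 + (13911/16951)*ζ^4 + (14898/16951)*ζ^5 + (8616/16951)*ζ^6 + (865/737)*ζ^7 + (1080/737)*ζ^8 + (10990/16951)*ζ^9)*q1 + ((14368/16951) + (-556/1541)*ζ + (-14775/16951)*ζ^2 + (-3475/16951)*ζ^3 + (7660/16951)*ζ^4 + (-96/737)*ζ^5 + (-8035/16951)*ζ^6 + (-466/1541)*ζ^7 + (2569/16951)*ζ^8 + (-6884/16951)*ζ^9)*q2 + ((17685/16951) + (6588/16951)*ζ + (-2710/16951)*ζ^2 + (8622/16951)*ζ^3 + (17525/16951)*ζ^4 + (-74/16951)*ζ^5 + (-4791/16951)*ζ^6 + (9437/16951)*ζ^7 + (13592/16951)*ζ^8 + (4427/16951)*ζ^9)*q3 + ((-22889/16951) + (-19859/16951)*ζ + (-16299/16951)*ζ^2 +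 (-13493/16951)*ζ^3 + (-676/737)*ζ^4 + (-11354/16951)*ζ^5 + (-7980/16951)*ζ^6 + (-24327/16951)*ζ^7 + (-25117/16951)*ζ^8 + (-5692/16951)*ζ^9)*q4 - (((1709/1541)*ζ^8 + (7179/16951)*ζ^9 + (-11987/16951)*ζ^10 + (-2328/16951)*ζ^11 + (2248/16951)*ζ^12 + (987/16951)*ζ^13 + (-29171/16951)*ζ^14 + (-59/16951)*ζ^15 + (11304/16951)*ζ^16 + (792/1541)*ζ^17 + (-32732/16951)*ζ^18 + (-6062/16951)*ζ^19 + (14228/16951)*ζ^20 + (4155/16951)*ζ^21 + (-553/1541)*ζ^22 + (196/16951)*ζ^23 + (4/11)*ζ^24 + (-1/11)*ζ^25 + (1/11)*ζ^26 + (-2/11)*ζ^27 + (4/11)*ζ^28)*c 0 + ((-3317/16951)*ζ^9 + (-9387/16951)*ζ^10 + (639/16951)*ζ^11 + (-6196/16951)*ζ^12 + (5314/16951)*ζ^13 + (6190/16951)*ζ^14 + (431/16951)*ζ^15 + (-1029/1541)*ζ^16 + (1999/16951)*ζ^17 + (-17546/16951)*ζ^18 + (5140/16951)*ζ^19 + (4625/16951)*ζ^20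 + (5458/16951)*ζ^21 + (-746/1541)*ζ^22 + (-5068/16951)*ζ^23 + (4155/16951)*ζ^24 + (5575/16951)*ζ^25 + (-5298/16951)*ζ^26)*c 1 + ((1709/1541)*ζ^9 + (7179/16951)*ζ^10 + (-11987/16951)*ζ^11 + (43/737)*ζ^12 + (20156/16951)*ζ^13 + (774/737)*ζ^14 + (-15519/16951)*ζ^15 + (1057/16951)*ζ^16 + (2909/16951)*ζ^17 + (10777/16951)*ζ^18 + (-210/737)*ζ^19 + (13048/16951)*ζ^20 + (-1/11)*ζ^21 + (1/11)*ζ^22 + (-2/11)*ζ^23 + (4/11)*ζ^24)*c 2 + ((14368/16951)*ζ^6 + (-20484/16951)*ζ^7 + (-8659/16951)*ζ^8 + (11300/16951)*ζ^9 + (-11754/16951)*ζ^10 + (-25637/16951)*ζ^11 + (-9446/16951)*ζ^12 + (-1097/16951)*ζ^13 + (-18010/16951)*ζ^14 + (-21498/16951)*ζ^15 + (4886/16951)*ζ^16 + (100/253)*ζ^17 + (-172/253)*ζ^18 + (-31191/16951)*ζ^19 + (-9144/16951)*ζ^20 + (14228/16951)*ζ^21 + (4155/16951)*ζ^22 + (-9165/16951)*ζ^23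 + (-4427/16951)*ζ^24)*c 3 + ((-1) + ζ + (-4/11)*ζ^6 + (2/11)*ζ^7 + (16144/16951)*ζ^8 + (-9556/16951)*ζ^9 + (-9298/16951)*ζ^10 + (-7160/16951)*ζ^11 + (27395/16951)*ζ^12 + (-20681/16951)*ζ^13 + (1447/16951)*ζ^14 + (-140/16951)*ζ^15 + (24639/16951)*ζ^16 + (-16948/16951)*ζ^17 + (6151/16951)*ζ^18 + (25181/16951)*ζ^19 + (37006/16951)*ζ^20 + (-387/16951)*ζ^21 + (-9463/16951)*ζ^22 + (-790/16951)*ζ^23 + (19425/16951)*ζ^24 + (5692/16951)*ζ^25)*c 4 + ((4/11)*ζ^2 + (-2/11)*ζ^3 + (-2/11)*ζ^5 + (2/11)*ζ^6)) * hΦ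

end P11

namespace P11
def dd (ζ : ℂ) : ZMod 5 → ℂ := ![ζ^2-ζ^9, ζ^10-ζ^1, ζ^6-ζ^5, ζ^8-ζ^3, ζ^7-ζ^4]

lemma chi_pow (χ : AddChar (ZMod 11) ℂ) (a : ZMod 11) : χ a = χ 1 ^ a.val := by
  conv_lhs => rw [← ZMod.natCast_zmod_val a, ← nsmul_one, AddChar.map_nsmul_eq_pow]

lemma chi_phi (χ : AddChar (ZMod 11) ℂ) (hχ : χ.IsPrimitive) :
    1+χ 1+χ 1^2+χ 1^3+χ 1^4+χ 1^5+χ 1^6+χ 1^7+χ 1^8+χ 1^9+χ 1^10=0 := by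
  have h := AddChar.sum_mulShift 1 hχ
  simp only [mul_one] at h
  rw [if_neg (by decide)] at h
  rw [Finset.sum_congr rfl (fun a _ => chi_pow χ a)] at h
  have h2 : ∑ i : Fin 11, χ 1 ^ i.val = 0 := by
    rw [Nat.cast_zero] at h
    exact h
  simpa [Fin.sum_univ_succ, ← add_assoc] using h2

section
variable {V : Type} [AddCommGroup V] [Module ℂ V] 
    (ρ : Representation ℂ PSL2F11 V)

lemma quintic (χ : AddChar (ZMod 11) ℂ) (hχ : χ.IsPrimitive) (i : ZMod 5) (s : ℂ)
    (hs : s = χ 1+χ 1^3+χ 1^4+χ 1^5+χ 1^9) :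
    (-1) + (-1-s) * χ (1 * 3 ^ i.val) + χ (2 * 3 ^ i.val) + (-1) * χ (3 * 3 ^ i.val)
      + (-s) * χ (4 * 3 ^ i.val) + χ (5 * 3 ^ i.val) = 0 := by
  have hΦ := chi_phi χ hχ
  subst hs
  simp only [chi_pow χ (_ * _)]
  generalize χ 1 = ζ at *
  fin_cases i
  · change (-1) + _ * ζ^1 + ζ^2 + (-1) * ζ^3 + _ * ζ^4 + ζ^5 = 0
    linear_combination ((-1) + ζ^2 + (-1)*ζ^3) * hΦ
  · change (-1) + _ * ζ^3 + ζ^6 + (-1) * ζ^9 + _ * ζ^1 + ζ^4 = 0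
    linear_combination ((-1) + ζ + (-1)*ζ^2) * hΦ
  · change (-1) + _ * ζ^9 + ζ^7 + (-1) * ζ^5 + _ * ζ^3 + ζ^1 = 0
    linear_combination ((-1) + 2*ζ + (-1)*ζ^2 + (-1)*ζ^4 + ζ^7 + (-1)*ζ^8) * hΦ
  · change (-1) + _ * ζ^5 + ζ^10 + (-1) * ζ^4 + _ * ζ^9 + ζ^3 = 0
    linear_combination ((-1) + ζ + ζ^3 + (-2)*ζ^4 + ζ^7 + (-1)*ζ^8) * hΦ
  · change (-1) + _ * ζ^4 + ζ^8 + (-1) * ζ^1 + _ * ζ^5 + ζ^9 = 0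
    linear_combination ((-1) + ζ^2 + (-1)*ζ^4) * hΦ

lemma c_eqn (χ : AddChar (ZMod 11) ℂ) (hχ : χ.IsPrimitive) (x : Module.Basis (ZMod 5) ℂ V)
    (hU : ∀ i j, ρ (gU j) (x i) = χ (j * 3 ^ i.val) • x i)
    (hT : ∀ i j, ρ (gT j) (x i) = x (i + j))
    (c : ZMod 5 → ℂ) (hW : ∀ i, ρ gW (x i) = ∑ k, c (k + i) • x k)  (s : ℂ)
    (hs : s = χ 1+χ 1^3+χ 1^4+χ 1^5+χ 1^9) (l : ZMod 5) :
    (if l = 0 then (-1) else 0)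
      + (-1-s)*(χ (nI 1) * χ (nI 1 * 3 ^ l.val) * c (l - eE 1))
      + (χ (nI 2) * χ (nI 2 * 3 ^ l.val) * c (l - eE 2))
      + (-1)*(χ (nI 3) * χ (nI 3 * 3 ^ l.val) * c (l - eE 3))
      + (-s)*(χ (nI 4) * χ (nI 4 * 3 ^ l.val) * c (l - eE 4))
      + (χ (nI 5) * χ (nI 5 * 3 ^ l.val) * c (l - eE 5)) = 0 := by
  have hQ : ∀ v : V, (-1 : ℂ) • v + (-1-s) • ρ (gU 1) v + ρ (gU 2) v + (-1 : ℂ) • ρ (gU 3) v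
      + (-s) • ρ (gU 4) v + ρ (gU 5) v = 0 := by
    intro v
    have : (-1 : ℂ) • LinearMap.id + (-1-s) • ρ (gU 1) + ρ (gU 2) + (-1 : ℂ) • ρ (gU 3)
      + (-s) • ρ (gU 4) + ρ (gU 5) = 0 := by
      refine x.ext fun i => ?_
      simp only [LinearMap.add_apply, LinearMap.smul_apply, hU, LinearMap.id_apply, smul_smul,
        ← add_smul, quintic χ hχ i s hs, LinearMap.zero_apply, zero_smul]
    have := congrArg (fun f => f v) this
    simpa only [LinearMap.add_apply, LinearMap.smul_apply, LinearMap.id_apply, LinearMap.zero_apply] using this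
  have h := congrArg (fun v => x.repr (ρ gW v) l) (hQ (ρ gW (x 0)))
  have h0 : ρ gW (ρ gW (x 0)) = x 0 := WW ρ (x 0)
  have hj : ∀ j, j ≠ 0 → x.repr (ρ gW (ρ (gU j) (ρ gW (x 0)))) l
      = χ (nI j) * χ (nI j * 3 ^ l.val) * c (l - eE j) := by
    intro j hj
    rw [← Module.End.mul_apply, ← map_mul, ← Module.End.mul_apply, ← map_mul, gW_gU_gW j hj]
    simp only [map_mul, Module.End.mul_apply, hU, hW, hT, map_smul, map_sum, Finsupp.smul_apply,
      Finsupp.coe_finsetSum, Finset.sum_apply, Module.Basis.repr_self, Finsupp.single_apply, smul_eq_mul]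
    rw [Finset.sum_eq_single (l - eE j)]
    · simp only [sub_add_cancel, if_true, add_zero]
      rw [ZMod.val_zero, pow_zero, mul_one]
      ring
    · intro b _ hb
      rw [if_neg]
      · simp
      · rintro rfl; simp at hb
    · simp
  simp only [map_add, map_smul, Finsupp.add_apply, Finsupp.smul_apply, h0, hj 1 (by decide), hj 2 (by decide),
    hj 3 (by decide), hj 4 (by decide), hj 5 (by decide), map_zero, Finsupp.zero_apply,
    Module.Basis.repr_self, Finsupp.single_apply, smul_eq_mul] at h
  have h5 : (if l = 0 then (-1 : ℂ) else 0) = -1 * if 0 = l then 1 else 0 := by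
    by_cases hl : l = 0
    · simp [hl]
    · simp [hl, Ne.symm hl]
  rw [h5]; exact h

lemma V_basis [FiniteDimensional ℂ V]
    (hdim : Module.finrank ℂ V = 5)
    (hirr : ∀ W : Submodule ℂ V,
      (∀ g : PSL2F11, ∀ v ∈ W, ρ g v ∈ W) → W = ⊥ ∨ W = ⊤) :
    ∃ χ : AddChar (ZMod 11) ℂ, χ.IsPrimitive ∧ ∃ x : Module.Basis (ZMod 5) ℂ V,
      (∀ i j, ρ (gU j) (x i) = χ (j * 3 ^ i.val) • x i) ∧
      (∀ i j, ρ (gT j) (x i) = x (i + j)) ∧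
      ∀ i, ρ gW (x i) = ∑ k, (gam (χ 1) * dd (χ 1) (k + i)) • x k := by
  obtain ⟨χ, hχ, x, hU, hT, c, hW⟩ := V_basis0 ρ hdim hirr
  refine ⟨χ, hχ, x, hU, hT, ?_⟩
  have hc : ∀ k, c k = gam (χ 1) * dd (χ 1) k := by
    have hq := c_eqn ρ χ hχ x hU hT c hW _ rfl
    have hΦ := chi_phi χ hχ
    simp only [chi_pow χ (nI _), chi_pow χ (_ * _)] at hq
    generalize χ 1 = ζ at *
    obtain ⟨c0, c1, c2, c3, c4⟩ := cval ζ _ c rfl hΦ (hq 0) (hq 1) (hq 2) (hq 3) (hq 4)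
    intro k
    fin_cases k
    · exact c0
    · rw [← pow_one ζ] at c1
      simp only [pow_one] at c1
      refine c1.trans ?_
      change _ = gam ζ * (ζ^10 - ζ^1)
      rw [pow_one]
    · exact c2
    · exact c3
    · exact c4
  simpa only [hc] using hW
end
end P11

namespace P11
section
variable {V : Type} [AddCommGroup V] [Module ℂ V]
    (ρ : Representation ℂ PSL2F11 V)

/-- the action on functions on the dual as a representation -/
noncomputable def symRep : Representation ℂ PSL2F11 (Module.Dual ℂ V → ℂ) where
  toFun g :=
    { toFun := symAct ρ g
      map_add' := fun _ _ => rfl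
      map_smul' := fun _ _ => rfl }
  map_one' := by
    ext f φ
    change f (φ ∘ₗ ρ 1) = f φ
    rw [map_one]
    rfl
  map_mul' g h := by
    ext f φ
    change f (φ ∘ₗ ρ (g * h)) = f ((φ ∘ₗ ρ g) ∘ₗ ρ h)
    rw [map_mul]
    rfl

lemma symRep_apply (g) (f : Module.Dual ℂ V → ℂ) (φ) : symRep ρ g f φ = f (φ ∘ₗ ρ g) := rfl

lemma symRep_mul (g) (f f' : Module.Dual ℂ V → ℂ) :
    symRep ρ g (f * f') = symRep ρ g f * symRep ρ g f' := rfl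

variable (x : Module.Basis (ZMod 5) ℂ V)

/-- coordinate functions -/
noncomputable def XX (i : ZMod 5) : Module.Dual ℂ V → ℂ := fun φ => φ (x i)

noncomputable def ev (t : ZMod 5 → ℂ) : Module.Dual ℂ V := x.constr ℂ t
lemma XX_ev (t : ZMod 5 → ℂ) (i) : XX x i (ev x t) = t i := by simp [XX, ev]

/-- cubic monomials -/
noncomputable def X3 (i j k : ZMod 5) : Module.Dual ℂ V → ℂ := XX x i * XX x j * XX x k

lemma symPow_eq : symPow V 3 = Submodule.span ℂ {f | ∃ i j k, f = X3 x i j k} := by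
  apply le_antisymm
  · rw [symPow, Submodule.span_le]
    rintro f ⟨v, rfl⟩
    have : (fun φ : Module.Dual ℂ V => ∏ i, φ (v i)) =
        ∑ i, ∑ j, ∑ k, (x.repr (v 0) i * x.repr (v 1) j * x.repr (v 2) k) • X3 x i j k := by
      ext φ
      have h : ∀ m, φ (v m) = ∑ i, x.repr (v m) i * φ (x i) := by
        intro m
        conv_lhs => rw [← x.sum_repr (v m), map_sum]
        simp
      rw [Fin.prod_univ_three, h 0, h 1, h 2, Finset.sum_mul_sum, Finset.sum_mul]
      simp only [Finset.sum_apply, Pi.smul_apply, X3, XX, Pi.mul_apply, smul_eq_mul]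
      refine Finset.sum_congr rfl fun i _ => ?_
      rw [Finset.sum_mul]
      refine Finset.sum_congr rfl fun j _ => ?_
      rw [Finset.mul_sum]
      refine Finset.sum_congr rfl fun k _ => ?_
      ring
    rw [this]
    exact Submodule.sum_mem _ fun i _ => Submodule.sum_mem _ fun j _ => Submodule.sum_mem _ fun k _ =>
      Submodule.smul_mem _ _ (Submodule.subset_span ⟨i, j, k, rfl⟩)
  · rw [Submodule.span_le]
    rintro f ⟨i, j, k, rfl⟩
    refine Submodule.subset_span ⟨![x i, x j, x k], ?_⟩
    ext φ
    simp [Fin.prod_univ_three, X3, XX]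

lemma X3_mem (i j k) : X3 x i j k ∈ symPow V 3 := by
  rw [symPow_eq x]; exact Submodule.subset_span ⟨i, j, k, rfl⟩

lemma symPow_stable (g) (f) (hf : f ∈ symPow V 3) : symRep ρ g f ∈ symPow V 3 := by
  have : symPow V 3 ≤ (symPow V 3).comap (symRep ρ g) := by
    conv_lhs => rw [symPow]
    rw [Submodule.span_le]
    rintro f ⟨v, rfl⟩
    exact Submodule.subset_span ⟨fun i => ρ g (v i), rfl⟩
  exact this hf

noncomputable def aX : MvPolynomial (ZMod 5) ℂ →ₐ[ℂ] (Module.Dual ℂ V → ℂ) := MvPolynomial.aeval (XX x)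

lemma aX_ev (p : MvPolynomial (ZMod 5) ℂ) (t) : aX x p (ev x t) = MvPolynomial.eval t p := by
  induction p using MvPolynomial.induction_on with
  | C a => simp [aX]
  | add p q hp hq => simp [hp, hq]
  | mul_X p i hp => rw [map_mul, Pi.mul_apply, hp, map_mul]; simp [aX, XX_ev]

lemma aX_inj : Function.Injective (aX x) := by
  intro p q h
  refine MvPolynomial.funext fun t => ?_
  rw [← aX_ev x, ← aX_ev x, h]

lemma mono_prod (m : Multiset (ZMod 5)) :
    aX x (MvPolynomial.monomial (Multiset.toFinsupp m) 1) = (m.map (XX x)).prod := by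
  induction m using Multiset.induction with
  | empty => simp
  | cons a s ih =>
    rw [← Multiset.singleton_add, map_add, Multiset.map_add, Multiset.prod_add, ← ih,
      Multiset.toFinsupp_singleton]
    have : MvPolynomial.monomial (Finsupp.single a 1 + Multiset.toFinsupp s) (1 : ℂ) =
        MvPolynomial.X a * MvPolynomial.monomial (Multiset.toFinsupp s) 1 := by
      rw [MvPolynomial.X, MvPolynomial.monomial_mul, one_mul]
    rw [this, map_mul]
    simp [aX]

include x in
lemma symPow_finrank : Module.finrank ℂ (symPow V 3) = 35 := by
  let B : Sym (ZMod 5) 3 → (Module.Dual ℂ V → ℂ) := fun s => (s.1.map (XX x)).prod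
  have hli : LinearIndependent ℂ B := by
    have h1 : LinearIndependent ℂ (fun s : Sym (ZMod 5) 3 =>
        (MvPolynomial.monomial (Multiset.toFinsupp s.1) (1 : ℂ))) := by
      have := (MvPolynomial.basisMonomials (ZMod 5) ℂ).linearIndependent.comp
        (fun s : Sym (ZMod 5) 3 => Multiset.toFinsupp s.1)
        (Multiset.toFinsupp.injective.comp Subtype.val_injective)
      simpa [Function.comp_def] using this
    have h2 := h1.map' (aX x).toLinearMap (LinearMap.ker_eq_bot.mpr (aX_inj x))
    have hB : B = (aX x).toLinearMap ∘ (fun s : Sym (ZMod 5) 3 =>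
        (MvPolynomial.monomial (Multiset.toFinsupp s.1) (1 : ℂ))) :=
      funext fun s => (mono_prod x s.1).symm
    rw [hB]
    exact h2
  have hs : symPow V 3 = Submodule.span ℂ (Set.range B) := by
    rw [symPow_eq x]
    congr 1
    ext f
    constructor
    · rintro ⟨i, j, k, rfl⟩
      refine ⟨⟨{i, j, k}, by simp⟩, ?_⟩
      simp [B, X3, mul_assoc]
    · rintro ⟨⟨s, hs⟩, rfl⟩
      obtain ⟨i, j, k, rfl⟩ := Multiset.card_eq_three.mp hs
      refine ⟨i, j, k, ?_⟩
      simp [B, X3, mul_assoc]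
  rw [hs, finrank_span_eq_card hli, Sym.card_sym_eq_multichoose, ZMod.card, Nat.multichoose_eq]
  decide

section act
variable (χ : AddChar (ZMod 11) ℂ) 
  (hU : ∀ i j, ρ (gU j) (x i) = χ (j * 3 ^ i.val) • x i)
  (hT : ∀ i j, ρ (gT j) (x i) = x (i + j))

include hU in
lemma U_X (i j) : symRep ρ (gU j) (XX x i) = χ (j * 3 ^ i.val) • XX x i := by
  ext φ; simp [symRep_apply, XX, hU]

include hT in
lemma T_X (i j) : symRep ρ (gT j) (XX x i) = XX x (i + j) := by
  ext φ; simp [symRep_apply, XX, hT]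

include hU in
lemma U_X3 (i j k l) : symRep ρ (gU l) (X3 x i j k) =
    χ (l * (3 ^ i.val + 3 ^ j.val + 3 ^ k.val)) • X3 x i j k := by
  rw [X3, symRep_mul, symRep_mul, U_X ρ x χ hU, U_X ρ x χ hU, U_X ρ x χ hU, mul_add, mul_add,
    AddChar.map_add_eq_mul, AddChar.map_add_eq_mul]
  ext φ
  simp only [Pi.mul_apply, Pi.smul_apply, smul_eq_mul]; ring

include hT in
lemma T_X3 (i j k l) : symRep ρ (gT l) (X3 x i j k) = X3 x (i + l) (j + l) (k + l) := by
  rw [X3, symRep_mul, symRep_mul, T_X ρ x hT, T_X ρ x hT, T_X ρ x hT, X3]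

variable (hχ : χ.IsPrimitive)
include hχ hU in
lemma PU_M (l : ZMod 11) (y) (hy : y ∈ symPow V 3) : PU (symRep ρ) χ l y ∈
    Submodule.span ℂ {f | ∃ i j k : ZMod 5, (3 ^ i.val + 3 ^ j.val + 3 ^ k.val : ZMod 11) = l ∧ f = X3 x i j k} := by
  set Q := Submodule.span ℂ {f | ∃ i j k : ZMod 5, (3 ^ i.val + 3 ^ j.val + 3 ^ k.val : ZMod 11) = l ∧ f = X3 x i j k}
  have : symPow V 3 ≤ Q.comap (PU (symRep ρ) χ l) := by
    rw [symPow_eq x, Submodule.span_le]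
    rintro f ⟨i, j, k, rfl⟩
    simp only [Submodule.comap_coe, Set.mem_preimage, SetLike.mem_coe]
    rw [PU, pr_of_eig (AU (symRep ρ)) χ hχ _ l _ (U_X3 ρ x χ hU i j k)]
    split_ifs with h
    · exact Submodule.subset_span ⟨i, j, k, h.symm, rfl⟩
    · exact Q.zero_mem
  exact this hy

/-- coefficient of `X_a^2 X_b` -/
noncomputable def BB (a b : ZMod 5) : (Module.Dual ℂ V → ℂ) →ₗ[ℂ] ℂ where
  toFun f := (f (ev x (Pi.single a 1 + Pi.single b 1)) - f (ev x (Pi.single a 1 - Pi.single b 1))) / 2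
    - f (ev x (Pi.single b 1))
  map_add' f g := by simp only [Pi.add_apply]; ring
  map_smul' c f := by simp only [Pi.smul_apply, smul_eq_mul, RingHom.id_apply]; ring

lemma BB_mul (a b : ZMod 5) (f g h : Module.Dual ℂ V → ℂ) (fa fb ga gb ha hb : ℂ)
    (hf : ∀ s t : ℂ, f (ev x (s • Pi.single a 1 + t • Pi.single b 1)) = s * fa + t * fb)
    (hg : ∀ s t : ℂ, g (ev x (s • Pi.single a 1 + t • Pi.single b 1)) = s * ga + t * gb)
    (hh : ∀ s t : ℂ, h (ev x (s • Pi.single a 1 + t • Pi.single b 1)) = s * ha + t * hb) :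
    BB x a b (f * g * h) = fa * ga * hb + fa * gb * ha + fb * ga * ha := by
  have e1 : (Pi.single a 1 + Pi.single b 1 : ZMod 5 → ℂ) = (1:ℂ) • Pi.single a 1 + (1:ℂ) • Pi.single b 1 := by simp
  have e2 : (Pi.single a 1 - Pi.single b 1 : ZMod 5 → ℂ) = (1:ℂ) • Pi.single a 1 + (-1:ℂ) • Pi.single b 1 := by
    rw [one_smul, neg_one_smul, sub_eq_add_neg]
  have e3 : (Pi.single b 1 : ZMod 5 → ℂ) = (0:ℂ) • Pi.single a 1 + (1:ℂ) • Pi.single b 1 := by simp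
  have e0 : BB x a b (f * g * h) = ((f * g * h) (ev x (Pi.single a 1 + Pi.single b 1)) -
      (f * g * h) (ev x (Pi.single a 1 - Pi.single b 1))) / 2 - (f * g * h) (ev x (Pi.single b 1)) := rfl
  rw [e0, e1, e2]
  conv_lhs => arg 2; rw [e3]
  simp only [Pi.mul_apply, hf, hg, hh]
  ring

lemma BB_X3 (a b i j k : ZMod 5) :
    BB x a b (X3 x i j k) = 
      (if i = a then 1 else 0) * (if j = a then 1 else 0) * (if k = b then 1 else 0)
      + (if i = a then 1 else 0) * (if j = b then 1 else 0) * (if k = a then 1 else 0)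
      + (if i = b then 1 else 0) * (if j = a then 1 else 0) * (if k = a then 1 else 0) := by
  rw [X3]
  apply BB_mul <;> intro s t <;> simp [XX_ev, Pi.single_apply]

include hχ hU in
lemma BB_wt (a b : ZMod 5) (l : ZMod 11) (y) (hy : y ∈ symPow V 3)
    (hl : l ≠ 3 ^ a.val + 3 ^ a.val + 3 ^ b.val) : BB x a b (PU (symRep ρ) χ l y) = 0 := by
  have h := PU_M ρ x χ hU hχ l y hy
  have : Submodule.span ℂ {f | ∃ i j k : ZMod 5, (3 ^ i.val + 3 ^ j.val + 3 ^ k.val : ZMod 11) = l ∧ f = X3 x i j k} ≤ LinearMap.ker (BB x a b) := by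
    rw [Submodule.span_le]
    rintro f ⟨i, j, k, h, rfl⟩
    simp only [SetLike.mem_coe, LinearMap.mem_ker, BB_X3]
    have h1 : ¬ (i = a ∧ j = a ∧ k = b) := by rintro ⟨rfl, rfl, rfl⟩; exact hl h.symm
    have h2 : ¬ (i = a ∧ j = b ∧ k = a) := by
      rintro ⟨rfl, rfl, rfl⟩; exact hl (by rw [← h]; ring)
    have h3 : ¬ (i = b ∧ j = a ∧ k = a) := by
      rintro ⟨rfl, rfl, rfl⟩; exact hl (by rw [← h]; ring)
    split_ifs <;> simp_all
  exact this h
end act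
end
end P11

namespace P11
lemma K0 {F : Type*} [Field F] [CharZero F] (ζ d0 d1 d2 d3 d4 : F) (hΦ : 1+ζ+ζ^2+ζ^3+ζ^4+ζ^5+ζ^6+ζ^7+ζ^8+ζ^9+ζ^10=0) (e0 : d0 = ζ^2-ζ^9) (e1 : d1 = ζ^10-ζ^1) (e2 : d2 = ζ^6-ζ^5) (e3 : d3 = ζ^8-ζ^3) (e4 : d4 = ζ^7-ζ^4) :
    d0*d0*d2 + d0*d3*d3 + d1*d1*d3 + d1*d4*d4 + d2*d2*d4 = 0 := by
  subst e0 e1 e2 e3 e4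
  linear_combination ((-1)*ζ^5 + ζ^6 + ζ^8 + (-3)*ζ^9 + 4*ζ^10 + (-2)*ζ^11 + 2*ζ^12 + (-4)*ζ^13 + 3*ζ^14 + (-1)*ζ^15 + (-1)*ζ^17 + ζ^18) * hΦ

lemma K1 {F : Type*} [Field F] [CharZero F] (ζ d0 d1 d2 d3 d4 : F) (hΦ : 1+ζ+ζ^2+ζ^3+ζ^4+ζ^5+ζ^6+ζ^7+ζ^8+ζ^9+ζ^10=0) (e0 : d0 = ζ^2-ζ^9) (e1 : d1 = ζ^10-ζ^1) (e2 : d2 = ζ^6-ζ^5) (e3 : d3 = ζ^8-ζ^3) (e4 : d4 = ζ^7-ζ^4) :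
    d0*d0*d3 + 2*d0*d1*d2 + 2*d0*d1*d4 + d0*d2*d2 + 2*d0*d3*d4 + d1*d1*d4 + 2*d1*d2*d3 + d1*d3*d3 + 2*d2*d3*d4 + d2*d4*d4 = 0 := by
  subst e0 e1 e2 e3 e4
  linear_combination ((-1)*ζ^6 + ζ^7 + 2*ζ^8 + (-3)*ζ^9 + ζ^10 + (-1)*ζ^13 + 3*ζ^14 + (-2)*ζ^15 + (-1)*ζ^16 + ζ^17) * hΦ

lemma K2 {F : Type*} [Field F] [CharZero F] (ζ d0 d1 d2 d3 d4 : F) (hΦ : 1+ζ+ζ^2+ζ^3+ζ^4+ζ^5+ζ^6+ζ^7+ζ^8+ζ^9+ζ^10=0) (e0 : d0 = ζ^2-ζ^9) (e1 : d1 = ζ^10-ζ^1) (e2 : d2 = ζ^6-ζ^5) (e3 : d3 = ζ^8-ζ^3) (e4 : d4 = ζ^7-ζ^4) :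
    2*d0*d0*d3 + d0*d0*d4 + d0*d1*d1 + 2*d0*d2*d2 + 2*d1*d1*d4 + d1*d2*d2 + 2*d1*d3*d3 + d2*d3*d3 + 2*d2*d4*d4 + d3*d4*d4 = 11 * (1+2*(ζ+ζ^3+ζ^4+ζ^5+ζ^9)) := by
  subst e0 e1 e2 e3 e4
  linear_combination ((-11) + (-11)*ζ + 22*ζ^2 + (-22)*ζ^3 + ζ^4 + (-1)*ζ^5 + 20*ζ^6 + (-2)*ζ^7 + 3*ζ^8 + (-19)*ζ^9 + 20*ζ^10 + (-14)*ζ^11 + 3*ζ^12 + 2*ζ^13 + (-3)*ζ^14 + (-3)*ζ^15 + 2*ζ^16 + 2*ζ^17 + ζ^18 + (-1)*ζ^19) * hΦ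

lemma K3 {F : Type*} [Field F] [CharZero F] (ζ d0 d1 d2 d3 d4 : F) (hΦ : 1+ζ+ζ^2+ζ^3+ζ^4+ζ^5+ζ^6+ζ^7+ζ^8+ζ^9+ζ^10=0) (e0 : d0 = ζ^2-ζ^9) (e1 : d1 = ζ^10-ζ^1) (e2 : d2 = ζ^6-ζ^5) (e3 : d3 = ζ^8-ζ^3) (e4 : d4 = ζ^7-ζ^4) :
    d0*d0*d0 + 2*d0*d1*d3 + 2*d0*d2*d3 + 2*d0*d2*d4 + d1*d1*d1 + 2*d1*d2*d4 + 2*d1*d3*d4 + d2*d2*d2 + d3*d3*d3 + d4*d4*d4 = 0 := by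
  subst e0 e1 e2 e3 e4
  linear_combination ((-1)*ζ^3 + ζ^4 + 3*ζ^6 + (-3)*ζ^7 + (-2)*ζ^8 + ζ^9 + ζ^10 + 2*ζ^11 + (-2)*ζ^12 + (-1)*ζ^13 + (-1)*ζ^14 + 2*ζ^15 + 3*ζ^16 + (-3)*ζ^17 + (-1)*ζ^19 + ζ^20) * hΦ

lemma K4 {F : Type*} [Field F] [CharZero F] (ζ d0 d1 d2 d3 d4 : F) (hΦ : 1+ζ+ζ^2+ζ^3+ζ^4+ζ^5+ζ^6+ζ^7+ζ^8+ζ^9+ζ^10=0) (e0 : d0 = ζ^2-ζ^9) (e1 : d1 = ζ^10-ζ^1) (e2 : d2 = ζ^6-ζ^5) (e3 : d3 = ζ^8-ζ^3) (e4 : d4 = ζ^7-ζ^4) :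
    d0*d0*d1 + 2*d0*d1*d3 + 2*d0*d2*d3 + 2*d0*d2*d4 + d0*d4*d4 + d1*d1*d2 + 2*d1*d2*d4 + 2*d1*d3*d4 + d2*d2*d3 + d3*d3*d4 = 0 := by
  subst e0 e1 e2 e3 e4
  linear_combination ((-1)*ζ^5 + 3*ζ^6 + (-3)*ζ^7 + ζ^9 + 2*ζ^11 + (-2)*ζ^12 + (-1)*ζ^14 + 3*ζ^16 + (-3)*ζ^17 + ζ^18) * hΦ

lemma K5 {F : Type*} [Field F] [CharZero F] (ζ d0 d1 d2 d3 d4 : F) (hΦ : 1+ζ+ζ^2+ζ^3+ζ^4+ζ^5+ζ^6+ζ^7+ζ^8+ζ^9+ζ^10=0) (e0 : d0 = ζ^2-ζ^9) (e1 : d1 = ζ^10-ζ^1) (e2 : d2 = ζ^6-ζ^5) (e3 : d3 = ζ^8-ζ^3) (e4 : d4 = ζ^7-ζ^4) :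
    2*d0*d0*d4 + 2*d0*d1*d1 + 2*d0*d1*d2 + 2*d0*d1*d3 + 2*d0*d1*d4 + 2*d0*d2*d3 + 2*d0*d2*d4 + 2*d0*d3*d4 + 2*d1*d2*d2 + 2*d1*d2*d3 + 2*d1*d2*d4 + 2*d1*d3*d4 + 2*d2*d3*d3 + 2*d2*d3*d4 + 2*d3*d4*d4 = 0 := by
  subst e0 e1 e2 e3 e4
  linear_combination (2*ζ^4 + (-2)*ζ^5 + 2*ζ^6 + (-4)*ζ^8 + 2*ζ^10 + (-4)*ζ^11 + 4*ζ^12 + (-2)*ζ^13 + 4*ζ^15 + (-2)*ζ^17 + 2*ζ^18 + (-2)*ζ^19) * hΦ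

lemma K6 {F : Type*} [Field F] [CharZero F] (ζ d0 d1 d2 d3 d4 : F) (hΦ : 1+ζ+ζ^2+ζ^3+ζ^4+ζ^5+ζ^6+ζ^7+ζ^8+ζ^9+ζ^10=0) (e0 : d0 = ζ^2-ζ^9) (e1 : d1 = ζ^10-ζ^1) (e2 : d2 = ζ^6-ζ^5) (e3 : d3 = ζ^8-ζ^3) (e4 : d4 = ζ^7-ζ^4) :
    2*d0*d0*d1 + 2*d0*d0*d2 + 2*d0*d1*d2 + 2*d0*d1*d4 + 2*d0*d3*d3 + 2*d0*d3*d4 + 2*d0*d4*d4 + 2*d1*d1*d2 + 2*d1*d1*d3 + 2*d1*d2*d3 + 2*d1*d4*d4 + 2*d2*d2*d3 + 2*d2*d2*d4 + 2*d2*d3*d4 + 2*d3*d3*d4 = 0 := by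
  subst e0 e1 e2 e3 e4
  linear_combination ((-4)*ζ^5 + 4*ζ^6 + 6*ζ^8 + (-12)*ζ^9 + 10*ζ^10 + (-4)*ζ^11 + 4*ζ^12 + (-10)*ζ^13 + 12*ζ^14 + (-6)*ζ^15 + (-4)*ζ^17 + 4*ζ^18) * hΦ

set_option maxHeartbeats 4000000 in
lemma cub0 {F : Type*} [Field F] [CharZero F] (d0 d1 d2 d3 d4 t0 t1 t2 t3 t4 v : F)
    (h0 : d0*d0*d2 + d0*d3*d3 + d1*d1*d3 + d1*d4*d4 + d2*d2*d4 = 0)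
    (h1 : d0*d0*d3 + 2*d0*d1*d2 + 2*d0*d1*d4 + d0*d2*d2 + 2*d0*d3*d4 + d1*d1*d4 + 2*d1*d2*d3 + d1*d3*d3 + 2*d2*d3*d4 + d2*d4*d4 = 0)
    (h2 : 2*d0*d0*d3 + d0*d0*d4 + d0*d1*d1 + 2*d0*d2*d2 + 2*d1*d1*d4 + d1*d2*d2 + 2*d1*d3*d3 + d2*d3*d3 + 2*d2*d4*d4 + d3*d4*d4 = v)
    (h3 : d0*d0*d0 + 2*d0*d1*d3 + 2*d0*d2*d3 + 2*d0*d2*d4 + d1*d1*d1 + 2*d1*d2*d4 + 2*d1*d3*d4 + d2*d2*d2 + d3*d3*d3 + d4*d4*d4 = 0)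
    (h4 : d0*d0*d1 + 2*d0*d1*d3 + 2*d0*d2*d3 + 2*d0*d2*d4 + d0*d4*d4 + d1*d1*d2 + 2*d1*d2*d4 + 2*d1*d3*d4 + d2*d2*d3 + d3*d3*d4 = 0)
    (h5 : 2*d0*d0*d4 + 2*d0*d1*d1 + 2*d0*d1*d2 + 2*d0*d1*d3 + 2*d0*d1*d4 + 2*d0*d2*d3 + 2*d0*d2*d4 + 2*d0*d3*d4 + 2*d1*d2*d2 + 2*d1*d2*d3 + 2*d1*d2*d4 + 2*d1*d3*d4 + 2*d2*d3*d3 + 2*d2*d3*d4 + 2*d3*d4*d4 = 0)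
    (h6 : 2*d0*d0*d1 + 2*d0*d0*d2 + 2*d0*d1*d2 + 2*d0*d1*d4 + 2*d0*d3*d3 + 2*d0*d3*d4 + 2*d0*d4*d4 + 2*d1*d1*d2 + 2*d1*d1*d3 + 2*d1*d2*d3 + 2*d1*d4*d4 + 2*d2*d2*d3 + 2*d2*d2*d4 + 2*d2*d3*d4 + 2*d3*d3*d4 = 0) :
    (d0*t0 + d1*t1 + d2*t2 + d3*t3 + d4*t4)^2*(d2*t0 + d3*t1 + d4*t2 + d0*t3 + d1*t4) + (d1*t0 + d2*t1 + d3*t2 + d4*t3 + d0*t4)^2*(d3*t0 + d4*t1 + d0*t2 + d1*t3 + d2*t4) + (d2*t0 + d3*t1 + d4*t2 + d0*t3 + d1*t4)^2*(d4*t0 + d0*t1 + d1*t2 + d2*t3 + d3*t4) + (d3*t0 + d4*t1 + d0*t2 + d1*t3 + d2*t4)^2*(d0*t0 + d1*t1 + d2*t2 + d3*t3 + d4*t4) + (d4*t0 + d0*t1 + d1*t2 + d2*t3 + d3*t4)^2*(d1*t0 + d2*t1 + d3*t2 + d4*t3 + d0*t4) =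
    v * (t0^2*t2 + t1^2*t3 + t2^2*t4 + t3^2*t0 + t4^2*t1) := by
  linear_combination (t0*t0*t0 + t1*t1*t1 + t2*t2*t2 + t3*t3*t3 + t4*t4*t4) * h0 + (t0*t0*t1 + t1*t1*t2 + t2*t2*t3 + t3*t3*t4 + t4*t4*t0) * h1 + (t0*t0*t2 + t1*t1*t3 + t2*t2*t4 + t3*t3*t0 + t4*t4*t1) * h2 + (t0*t0*t3 + t1*t1*t4 + t2*t2*t0 + t3*t3*t1 + t4*t4*t2) * h3 + (t0*t0*t4 + t1*t1*t0 + t2*t2*t1 + t3*t3*t2 + t4*t4*t3) * h4 + (t0*t1*t2 + t1*t2*t3 + t2*t3*t4 + t3*t4*t0 + t4*t0*t1) * h5 + (t0*t1*t3 + t1*t2*t4 + t2*t3*t0 + t3*t4*t1 + t4*t0*t2) * h6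

set_option maxHeartbeats 2000000 in
lemma ns1 {F : Type*} [Field F] [CharZero F] (ζ α β γ d0 d1 d2 d3 d4 : F) (hΦ : 1+ζ+ζ^2+ζ^3+ζ^4+ζ^5+ζ^6+ζ^7+ζ^8+ζ^9+ζ^10=0) (e0 : d0 = ζ^2-ζ^9) (e1 : d1 = ζ^10-ζ^1) (e2 : d2 = ζ^6-ζ^5) (e3 : d3 = ζ^8-ζ^3) (e4 : d4 = ζ^7-ζ^4)
    (h0 : α*(d1*d3*d2 + d1*d1*d4 + d4*d3*d4) + β*(d2*d2*d1 + d2*d0*d3 + d0*d2*d3) + γ*(d4*d4*d2 + d4*d2*d4 + d2*d4*d4) = 0)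
    (h1 : α*(d1*d3*d3 + d1*d2*d4 + d0*d3*d4) + β*(d2*d2*d2 + d2*d1*d3 + d1*d2*d3) + γ*(d4*d4*d3 + d4*d3*d4 + d3*d4*d4) = 0)
    (h2 : α*(d4*d1*d0 + d4*d4*d2 + d2*d1*d2) + β*(d0*d0*d4 + d0*d3*d1 + d3*d0*d1) + γ*(d2*d2*d0 + d2*d0*d2 + d0*d2*d2) = 0) :
    α = 0 ∧ β = 0 ∧ γ = 0 := by
  subst e0 e1 e2 e3 e4
  refine ⟨?_, ?_, ?_⟩
  · linear_combination ((2/11) + (4/11)*ζ + (2/11)*ζ^3 + (3/11)*ζ^4 + (4/11)*ζ^6 + (1/11)*ζ^7 + (2/11)*ζ^8 + (4/11)*ζ^9)*h0 + ((1/11)*ζ^5 + (-1/11)*ζ^6)*h1 + ((1/11)*ζ^3 + (-1/11)*ζ^8)*h2 - (α*((-1) + ζ + (-2/11)*ζ^6 + (-2/11)*ζ^7 + (4/11)*ζ^8 + (-2/11)*ζ^9 + (2/11)*ζ^10 + (-9/11)*ζ^11 + (10/11)*ζ^13 + (4/11)*ζ^14 + (1/11)*ζ^15 + (4/11)*ζ^16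 + (-7/11)*ζ^17 + (-7/11)*ζ^19 + (-2/11)*ζ^20 + (10/11)*ζ^21 + (-9/11)*ζ^22 + (2/11)*ζ^23 + (-2/11)*ζ^25 + (4/11)*ζ^26) + β*((2/11)*ζ^9 + (2/11)*ζ^10 + (-3/11)*ζ^11 + (-9/11)*ζ^12 + (18/11)*ζ^13 + (-19/11)*ζ^14 + (4/11)*ζ^15 + (10/11)*ζ^16 + (-14/11)*ζ^17 + (10/11)*ζ^18 + (8/11)*ζ^19 + (-17/11)*ζ^20 + (16/11)*ζ^21 + (-7/11)*ζ^22 + (-1/11)*ζ^23 + (-2/11)*ζ^24 + (2/11)*ζ^25) + γ*((-6/11)*ζ^13 + (21/11)*ζ^15 + (-18/11)*ζ^16 + (18/11)*ζ^17 + (-30/11)*ζ^18 + (15/11)*ζ^19)) * hΦ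
  · linear_combination ((1/11) + (2/11)*ζ + (1/11)*ζ^2 + (2/11)*ζ^4 + (1/11)*ζ^5 + (1/11)*ζ^6 + (2/11)*ζ^8 + (1/11)*ζ^9)*h0 + ((-1/11)*ζ^2 + (1/11)*ζ^4 + (1/11)*ζ^5 + (-1/11)*ζ^6 + (-1/11)*ζ^7 + (1/11)*ζ^9)*h1 + ((1/11) + (2/11)*ζ + (2/11)*ζ^2 + (2/11)*ζ^3 + (1/11)*ζ^5 + (1/11)*ζ^6 + (2/11)*ζ^7)*h2 - (α*((-1/11)*ζ^6 + (2/11)*ζ^8 + (2/11)*ζ^9 + (-3/11)*ζ^10 + (-5/11)*ζ^11 + (2/11)*ζ^12 + (2/11)*ζ^13 + (4/11)*ζ^14 + (-1/11)*ζ^15 + (2/11)*ζ^16 + (-2/11)*ζ^17 + (-1/11)*ζ^18 + (-5/11)*ζ^19 + (3/11)*ζ^20 + (2/11)*ζ^21 + (2/11)*ζ^22 + (-3/11)*ζ^23 + (-3/11)*ζ^24 + (2/11)*ζ^25 + (1/11)*ζ^26) + β*((-1) + ζ + (2/11)*ζ^6 + (2/11)*ζ^7 + (-1/11)*ζ^8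 + (-1/11)*ζ^9 + (-2/11)*ζ^10 + (-9/11)*ζ^11 + (5/11)*ζ^12 + (1/11)*ζ^13 + (-6/11)*ζ^15 + (3/11)*ζ^16 + (5/11)*ζ^17 + (3/11)*ζ^18 + (-4/11)*ζ^19 + (3/11)*ζ^20 + (2/11)*ζ^21 + (-4/11)*ζ^22 + (4/11)*ζ^23 + (-4/11)*ζ^24) + γ*((3/11)*ζ^12 + (-3/11)*ζ^13 + (-6/11)*ζ^14 + (6/11)*ζ^15 + (-6/11)*ζ^16 + (18/11)*ζ^17 + (-12/11)*ζ^18 + (-3/11)*ζ^20 + (3/11)*ζ^21)) * hΦ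
  · linear_combination ((-2/33) + (-4/33)*ζ + (-2/33)*ζ^3 + (-4/33)*ζ^4 + (-4/33)*ζ^6 + (-2/33)*ζ^8 + (-4/33)*ζ^9)*h0 + ((-1/33)*ζ^3 + (-1/33)*ζ^5 + (1/33)*ζ^6 + (1/33)*ζ^8)*h1 + ((-1/33) + (-2/33)*ζ + (-2/33)*ζ^3 + (-1/33)*ζ^4 + (-2/33)*ζ^5 + (-1/33)*ζ^7 + (-2/33)*ζ^9)*h2 - (α*((2/33)*ζ^6 + (1/33)*ζ^7 + (-5/33)*ζ^8 + (4/33)*ζ^9 + (-2/33)*ζ^11 + (2/11)*ζ^12 + (-8/33)*ζ^13 + (-5/33)*ζ^15 + (-5/33)*ζ^16 + (1/3)*ζ^17 + (1/11)*ζ^19 + (4/33)*ζ^20 + (-8/33)*ζ^21 + (5/33)*ζ^22 + (-4/33)*ζ^23 + (1/33)*ζ^24 + (4/33)*ζ^25 + (-4/33)*ζ^26) + β*((-2/33)*ζ^6 + (-2/33)*ζ^7 + (5/33)*ζ^8 + (-1/11)*ζ^9 + (-4/33)*ζ^10 + (1/11)*ζ^11 + (16/33)*ζ^12 + (-23/33)*ζ^13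 + (20/33)*ζ^14 + (-4/33)*ζ^15 + (-8/33)*ζ^16 + (4/11)*ζ^17 + (-8/33)*ζ^18 + (-8/33)*ζ^19 + (16/33)*ζ^20 + (-23/33)*ζ^21 + (13/33)*ζ^22 + (-4/33)*ζ^25 + (4/33)*ζ^26) + γ*((-1) + ζ + (-1)*ζ^11 + (10/11)*ζ^12 + (3/11)*ζ^13 + (4/11)*ζ^14 + (-14/11)*ζ^15 + (10/11)*ζ^16 + (-9/11)*ζ^17 + (14/11)*ζ^18 + (-1)*ζ^19 + (3/11)*ζ^20)) * hΦ

set_option maxHeartbeats 2000000 in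
lemma ns2 {F : Type*} [Field F] [CharZero F] (ζ α β γ d0 d1 d2 d3 d4 : F) (hΦ : 1+ζ+ζ^2+ζ^3+ζ^4+ζ^5+ζ^6+ζ^7+ζ^8+ζ^9+ζ^10=0) (e0 : d0 = ζ^2-ζ^9) (e1 : d1 = ζ^10-ζ^1) (e2 : d2 = ζ^6-ζ^5) (e3 : d3 = ζ^8-ζ^3) (e4 : d4 = ζ^7-ζ^4)
    (h0 : α*(d0*d3*d0 + d0*d4*d4 + d1*d3*d4) + β*(d1*d1*d0 + d1*d2*d4 + d2*d1*d4) + γ*(d1*d2*d3 + d1*d3*d2 + d2*d2*d2) = 0)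
    (h1 : α*(d3*d1*d4 + d3*d3*d2 + d0*d1*d2) + β*(d4*d4*d4 + d4*d1*d2 + d1*d4*d2) + γ*(d4*d0*d2 + d4*d2*d0 + d1*d0*d0) = 0)
    (h2 : α*(d4*d2*d0 + d4*d4*d3 + d1*d2*d3) + β*(d0*d0*d0 + d0*d2*d3 + d2*d0*d3) + γ*(d0*d1*d3 + d0*d3*d1 + d2*d1*d1) = 0) :
    α = 0 ∧ β = 0 ∧ γ = 0 := by
  subst e0 e1 e2 e3 e4
  refine ⟨?_, ?_, ?_⟩
  · linear_combination ((1/33) + (2/33)*ζ + (1/33)*ζ^2 + (2/33)*ζ^6 + (2/33)*ζ^7 + (2/33)*ζ^8 + (1/33)*ζ^9)*h0 + ((-1/33)*ζ^3 + (-1/33)*ζ^5 + (1/33)*ζ^6 + (1/33)*ζ^8)*h1 + ((2/33) + (4/33)*ζ + (1/33)*ζ^2 + (1/33)*ζ^3 + (1/11)*ζ^4 + (4/33)*ζ^6 + (1/33)*ζ^7 + (1/11)*ζ^8 + (1/11)*ζ^9)*h2 - (α*((-1) + ζ + (-1/33)*ζ^7 + (-2/33)*ζ^8 + (-2/33)*ζ^9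 + (1/11)*ζ^10 + (-25/33)*ζ^11 + (10/11)*ζ^12 + (-3/11)*ζ^13 + (10/33)*ζ^14 + (-4/33)*ζ^15 + (4/33)*ζ^16 + (-1/33)*ζ^17 + (2/33)*ζ^18 + (-10/33)*ζ^19 + (5/33)*ζ^20 + (-7/33)*ζ^21 + (-1/11)*ζ^22 + (4/33)*ζ^23 + (2/33)*ζ^24 + (1/33)*ζ^25) + β*((1/33)*ζ^4 + (1/33)*ζ^5 + (1/33)*ζ^6 + (1/33)*ζ^7 + (-1/11)*ζ^8 + (2/11)*ζ^10 + (-4/33)*ζ^11 + (-1/11)*ζ^12 + (-1/33)*ζ^13 + (-8/33)*ζ^14 + (-1/33)*ζ^15 + (1/33)*ζ^16 + (2/33)*ζ^17 + (1/33)*ζ^18 + (5/33)*ζ^19 + (5/33)*ζ^21 + (-1/11)*ζ^23 + (4/33)*ζ^24 + (-1/11)*ζ^26 + (-1/33)*ζ^27 + (-1/33)*ζ^28) + γ*((4/33)*ζ^6 + (2/33)*ζ^7 + (-5/33)*ζ^8 + (2/33)*ζ^9 + (2/33)*ζ^10 + (-10/33)*ζ^11 + (10/33)*ζ^12 + (-14/33)*ζ^13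 + (8/33)*ζ^14 + (-10/33)*ζ^15 + (2/33)*ζ^16 + (7/33)*ζ^17 + (2/33)*ζ^18 + (-5/33)*ζ^19 + (10/33)*ζ^20 + (-10/33)*ζ^21 + (14/33)*ζ^22 + (-8/33)*ζ^23 + (2/33)*ζ^24 + (2/33)*ζ^25 + (-5/33)*ζ^26)) * hΦ
  · linear_combination ((-1/33) + (-2/33)*ζ + (-1/33)*ζ^2 + (-2/33)*ζ^6 + (-2/33)*ζ^7 + (-2/33)*ζ^8 + (-1/33)*ζ^9)*h0 + ((-1/11)*ζ^2 + (1/33)*ζ^3 + (-2/33)*ζ^5 + (2/33)*ζ^6 + (-1/33)*ζ^8 + (1/11)*ζ^9)*h1 + ((-2/33) + (-4/33)*ζ + (2/33)*ζ^2 + (-4/33)*ζ^3 + (-1/11)*ζ^4 + (-4/33)*ζ^6 + (-1/33)*ζ^7 + (-2/11)*ζ^9)*h2 - (α*((1/33)*ζ^7 + (2/33)*ζ^8 + (2/33)*ζ^9 + (-1/11)*ζ^10 + (-8/33)*ζ^11 + (3/11)*ζ^12 + (-10/33)*ζ^14 + (4/33)*ζ^15 + (5/33)*ζ^16 + (-14/33)*ζ^17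 + (7/33)*ζ^18 + (10/33)*ζ^19 + (-5/33)*ζ^20 + (-2/33)*ζ^21 + (3/11)*ζ^22 + (-4/33)*ζ^23 + (-2/33)*ζ^24 + (-1/33)*ζ^25) + β*((-1) + ζ + (-1/33)*ζ^4 + (-1/33)*ζ^5 + (-1/33)*ζ^6 + (-1/33)*ζ^7 + (2/11)*ζ^8 + (-2/11)*ζ^9 + (-1/11)*ζ^10 + (-29/33)*ζ^11 + (16/11)*ζ^12 + (-29/33)*ζ^13 + (38/33)*ζ^14 + (-23/33)*ζ^15 + (14/33)*ζ^16 + (-1/3)*ζ^17 + (14/33)*ζ^18 + (-29/33)*ζ^19 + (10/11)*ζ^20 + (-35/33)*ζ^21 + (4/11)*ζ^22 + (1/11)*ζ^23 + (-1/33)*ζ^24 + (-2/11)*ζ^25 + (2/11)*ζ^26 + (1/33)*ζ^27 + (1/33)*ζ^28) + γ*((-4/33)*ζ^6 + (1/33)*ζ^7 + (8/33)*ζ^8 + (-17/33)*ζ^9 + (16/33)*ζ^10 + (-5/33)*ζ^11 + (-4/33)*ζ^12 + (2/33)*ζ^13 + (13/33)*ζ^14 + (-14/33)*ζ^15 + (2/3)*ζ^16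 + (-25/33)*ζ^17 + (2/3)*ζ^18 + (-19/33)*ζ^19 + (1/3)*ζ^20 + (-2/33)*ζ^21 + (-8/33)*ζ^22 + (-7/33)*ζ^23 + (16/33)*ζ^24 + (-17/33)*ζ^25 + (8/33)*ζ^26 + (1/11)*ζ^27)) * hΦ
  · linear_combination ((2/33) + (4/33)*ζ + (2/33)*ζ^2 + (4/33)*ζ^6 + (4/33)*ζ^7 + (4/33)*ζ^8 + (2/33)*ζ^9)*h0 + ((1/11) + (2/11)*ζ + (2/11)*ζ^2 + (4/33)*ζ^3 + (1/33)*ζ^5 + (5/33)*ζ^6 + (2/11)*ζ^7 + (2/33)*ζ^8)*h1 + ((1/33) + (2/33)*ζ + (2/33)*ζ^2 + (2/33)*ζ^3 + (2/33)*ζ^6 + (2/33)*ζ^7)*h2 - (α*((-2/33)*ζ^7 + (-4/33)*ζ^8 + (-4/33)*ζ^9 + (1/11)*ζ^10 + (7/33)*ζ^11 + (2/11)*ζ^12 + (1/11)*ζ^13 + (-4/33)*ζ^14 + (-5/33)*ζ^15 + (5/33)*ζ^16 + (7/33)*ζ^17 + (1/33)*ζ^18 + (-8/33)*ζ^19 +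 (-1/3)*ζ^20 + (-2/33)*ζ^21 + (2/33)*ζ^23 + (4/33)*ζ^24 + (2/33)*ζ^25) + β*((2/33)*ζ^4 + (2/33)*ζ^5 + (-1/33)*ζ^6 + (-1/33)*ζ^7 + (-2/11)*ζ^10 + (-2/33)*ζ^11 + (3/11)*ζ^12 + (4/33)*ζ^13 + (-13/33)*ζ^14 + (-5/33)*ζ^15 + (5/33)*ζ^16 + (10/33)*ζ^17 + (-4/33)*ζ^18 + (-2/33)*ζ^19 + (-2/11)*ζ^20 + (4/33)*ζ^21 + (2/11)*ζ^22 + (2/33)*ζ^24 + (-2/33)*ζ^27 + (-2/33)*ζ^28) + γ*((-1) + ζ + (-1/11)*ζ^5 + (-1/33)*ζ^6 + (1/33)*ζ^7 + (2/33)*ζ^8 + (1/33)*ζ^9 + (-5/33)*ζ^10 + (-23/33)*ζ^11 + (38/33)*ζ^12 + (-4/33)*ζ^13 + (-5/33)*ζ^14 + (-1/3)*ζ^15 + (7/33)*ζ^16 + (1/3)*ζ^17 + (1/33)*ζ^18 + (-10/33)*ζ^19 + (-4/33)*ζ^20 + (-2/33)*ζ^21 + (1/33)*ζ^22 + (2/33)*ζ^23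 + (-5/33)*ζ^24 + (4/33)*ζ^25 + (2/33)*ζ^26)) * hΦ

end P11

namespace P11
section
variable {V : Type} [AddCommGroup V] [Module ℂ V]
    (ρ : Representation ℂ PSL2F11 V)
    (x : Module.Basis (ZMod 5) ℂ V)
    (χ : AddChar (ZMod 11) ℂ) (hχ : χ.IsPrimitive)
    (hU : ∀ i j, ρ (gU j) (x i) = χ (j * 3 ^ i.val) • x i)
    (hT : ∀ i j, ρ (gT j) (x i) = x (i + j))
    (hW : ∀ i, ρ gW (x i) = ∑ k, (gam (χ 1) * dd (χ 1) (k + i)) • x k)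

lemma gam_sq (ζ : ℂ) (hΦ : 1+ζ+ζ^2+ζ^3+ζ^4+ζ^5+ζ^6+ζ^7+ζ^8+ζ^9+ζ^10=0) : gam ζ ^ 2 = -1/11 := by
  unfold gam
  linear_combination (1/121 : ℂ) * (12 + (-8)*ζ + 8*ζ^4 + (-4)*ζ^7 + 4*ζ^8) * hΦ

lemma gam_ne (ζ : ℂ) (hΦ : 1+ζ+ζ^2+ζ^3+ζ^4+ζ^5+ζ^6+ζ^7+ζ^8+ζ^9+ζ^10=0) : gam ζ ≠ 0 := by
  intro h
  have := gam_sq ζ hΦ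
  rw [h] at this
  norm_num at this

include hW in
lemma W_X (i) (φ) : symRep ρ gW (XX x i) φ = ∑ k, gam (χ 1) * dd (χ 1) (k + i) * φ (x k) := by
  simp [symRep_apply, XX, hW]

include hW in
lemma BB_WX3 (a b i j k) : BB x a b (symRep ρ gW (X3 x i j k)) = gam (χ 1) ^ 3 *
    (dd (χ 1) (a + i) * dd (χ 1) (a + j) * dd (χ 1) (b + k) + dd (χ 1) (a + i) * dd (χ 1) (b + j) * dd (χ 1) (a + k)
      + dd (χ 1) (b + i) * dd (χ 1) (a + j) * dd (χ 1) (a + k)) := by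
  rw [X3, symRep_mul, symRep_mul]
  have h : ∀ (i : ZMod 5) (s t : ℂ), symRep ρ gW (XX x i) (ev x (s • Pi.single a 1 + t • Pi.single b 1)) =
      s * (gam (χ 1) * dd (χ 1) (a + i)) + t * (gam (χ 1) * dd (χ 1) (b + i)) := by
    intro i s t
    rw [W_X ρ x χ hW]
    have : ∀ k, ev x (s • Pi.single a 1 + t • Pi.single b 1) (x k) = 
      (s • Pi.single a 1 + t • Pi.single b 1 : ZMod 5 → ℂ) k := fun k => XX_ev x _ k
    simp only [this]
    simp only [Pi.add_apply, Pi.smul_apply, smul_eq_mul, mul_add, Finset.sum_add_distrib]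
    congr 1
    · rw [Finset.sum_eq_single a (fun b _ hb => by simp [hb]) (by simp)]
      simp; ring
    · rw [Finset.sum_eq_single b (fun b _ hb => by simp [hb]) (by simp)]
      simp; ring
  rw [BB_mul x a b _ _ _ _ _ _ _ _ _ (h i) (h j) (h k)]
  ring

lemma wt1 (i j k : ZMod 5) (h : (3 ^ i.val + 3 ^ j.val + 3 ^ k.val : ZMod 11) = 1) :
    X3 x i j k = X3 x 1 3 4 ∨ X3 x i j k = X3 x 2 2 3 ∨ X3 x i j k = X3 x 4 4 4 := by
  have : (i, j, k) ∈ [((1 : ZMod 5), (3 : ZMod 5), (4 : ZMod 5)), (1,4,3), (3,1,4), (3,4,1), (4,1,3), (4,3,1),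
    (2,2,3), (2,3,2), (3,2,2), (4,4,4)] := by
    revert i j k; decide
  simp only [List.mem_cons, Prod.mk.injEq, List.not_mem_nil, or_false] at this
  rcases this with ⟨rfl, rfl, rfl⟩ | ⟨rfl, rfl, rfl⟩ | ⟨rfl, rfl, rfl⟩ | ⟨rfl, rfl, rfl⟩ | ⟨rfl, rfl, rfl⟩ |
    ⟨rfl, rfl, rfl⟩ | ⟨rfl, rfl, rfl⟩ | ⟨rfl, rfl, rfl⟩ | ⟨rfl, rfl, rfl⟩ | ⟨rfl, rfl, rfl⟩
  iterate 6 (left; simp only [X3]; ring)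
  iterate 3 (right; left; simp only [X3]; ring)
  right; right; rfl

lemma wt10 (i j k : ZMod 5) (h : (3 ^ i.val + 3 ^ j.val + 3 ^ k.val : ZMod 11) = 10) :
    X3 x i j k = X3 x 0 3 4 ∨ X3 x i j k = X3 x 1 1 4 ∨ X3 x i j k = X3 x 1 2 2 := by
  have : (i, j, k) ∈ [((0 : ZMod 5), (3 : ZMod 5), (4 : ZMod 5)), (0,4,3), (3,0,4), (3,4,0), (4,0,3), (4,3,0),
    (1,1,4), (1,4,1), (4,1,1), (1,2,2), (2,1,2), (2,2,1)] := by
    revert i j k; decide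
  simp only [List.mem_cons, Prod.mk.injEq, List.not_mem_nil, or_false] at this
  rcases this with ⟨rfl, rfl, rfl⟩ | ⟨rfl, rfl, rfl⟩ | ⟨rfl, rfl, rfl⟩ | ⟨rfl, rfl, rfl⟩ | ⟨rfl, rfl, rfl⟩ |
    ⟨rfl, rfl, rfl⟩ | ⟨rfl, rfl, rfl⟩ | ⟨rfl, rfl, rfl⟩ | ⟨rfl, rfl, rfl⟩ | ⟨rfl, rfl, rfl⟩ | ⟨rfl, rfl, rfl⟩ | ⟨rfl, rfl, rfl⟩
  iterate 6 (left; simp only [X3]; ring)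
  iterate 3 (right; left; simp only [X3]; ring)
  iterate 3 (right; right; simp only [X3]; ring)

/-- products of weight zero -/
noncomputable def ZZ (m : ZMod 5) : Module.Dual ℂ V → ℂ := X3 x m m (m + 2)

lemma wt0 (i j k : ZMod 5) (h : (3 ^ i.val + 3 ^ j.val + 3 ^ k.val : ZMod 11) = 0) :
    ∃ m, X3 x i j k = ZZ x m := by
  have : ∃ m : ZMod 5, (i = m ∧ j = m ∧ k = m + 2) ∨ (i = m ∧ j = m + 2 ∧ k = m) ∨ (i = m + 2 ∧ j = m ∧ k = m) := by
    revert i j k; decide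
  obtain ⟨m, hm⟩ := this
  refine ⟨m, ?_⟩
  rcases hm with ⟨rfl, rfl, rfl⟩ | ⟨rfl, rfl, rfl⟩ | ⟨rfl, rfl, rfl⟩ <;> simp only [X3, ZZ] <;> ring

include hχ hU in
lemma mem3 (l : ZMod 11) (a b c : Module.Dual ℂ V → ℂ)
    (hw : ∀ i j k : ZMod 5, (3 ^ i.val + 3 ^ j.val + 3 ^ k.val : ZMod 11) = l →
      X3 x i j k = a ∨ X3 x i j k = b ∨ X3 x i j k = c)
    (y) (hy : y ∈ symPow V 3) (hyw : PU (symRep ρ) χ l y = y) :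
    ∃ α β γ : ℂ, y = α • a + β • b + γ • c := by
  have h := PU_M ρ x χ hU hχ l y hy
  rw [hyw] at h
  have h2 : y ∈ Submodule.span ℂ {a, b, c} := by
    refine Submodule.span_mono ?_ h
    rintro f ⟨i, j, k, h, rfl⟩
    exact hw i j k h
  obtain ⟨α, β, γ, h⟩ := Submodule.mem_span_triple.mp h2
  exact ⟨α, β, γ, h.symm⟩

include hχ hU hW in
lemma nz1 (y) (hy : y ∈ symPow V 3) (hyw : PU (symRep ρ) χ 1 y = y)
    (h0 : BB x 0 3 (symRep ρ gW y) = 0) (h1 : BB x 0 4 (symRep ρ gW y) = 0) 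
    (h2 : BB x 3 1 (symRep ρ gW y) = 0) : y = 0 := by
  obtain ⟨α, β, γ, rfl⟩ := mem3 ρ x χ hχ hU 1 _ _ _ (wt1 x) y hy hyw
  have hΦ := chi_phi χ hχ
  have hg := pow_ne_zero 3 (gam_ne _ hΦ)
  simp only [map_add, map_smul, smul_eq_mul, BB_WX3 ρ x χ hW] at h0 h1 h2
  generalize χ 1 = ζ at *
  obtain ⟨rfl, rfl, rfl⟩ := ns1 ζ α β γ _ _ _ _ _ hΦ rfl rfl rfl rfl rfl
    (by refine mul_left_cancel₀ hg ?_
        rw [mul_zero]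
        refine Eq.trans ?_ h0
        rw [mul_add, mul_add, mul_left_comm _ α, mul_left_comm _ β, mul_left_comm _ γ]
        rfl)
    (by refine mul_left_cancel₀ hg ?_
        rw [mul_zero]
        refine Eq.trans ?_ h1
        rw [mul_add, mul_add, mul_left_comm _ α, mul_left_comm _ β, mul_left_comm _ γ]
        rfl)
    (by refine mul_left_cancel₀ hg ?_
        rw [mul_zero]
        refine Eq.trans ?_ h2
        rw [mul_add, mul_add, mul_left_comm _ α, mul_left_comm _ β, mul_left_comm _ γ]
        rfl)
  simp

include hχ hU hW in
lemma nz10 (y) (hy : y ∈ symPow V 3) (hyw : PU (symRep ρ) χ 10 y = y)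
    (h0 : BB x 0 1 (symRep ρ gW y) = 0) (h1 : BB x 3 0 (symRep ρ gW y) = 0) 
    (h2 : BB x 4 1 (symRep ρ gW y) = 0) : y = 0 := by
  obtain ⟨α, β, γ, rfl⟩ := mem3 ρ x χ hχ hU 10 _ _ _ (wt10 x) y hy hyw
  have hΦ := chi_phi χ hχ
  have hg := pow_ne_zero 3 (gam_ne _ hΦ)
  simp only [map_add, map_smul, smul_eq_mul, BB_WX3 ρ x χ hW] at h0 h1 h2
  generalize χ 1 = ζ at *
  obtain ⟨rfl, rfl, rfl⟩ := ns2 ζ α β γ _ _ _ _ _ hΦ rfl rfl rfl rfl rfl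
    (by refine mul_left_cancel₀ hg ?_
        rw [mul_zero]
        refine Eq.trans ?_ h0
        rw [mul_add, mul_add, mul_left_comm _ α, mul_left_comm _ β, mul_left_comm _ γ]
        rfl)
    (by refine mul_left_cancel₀ hg ?_
        rw [mul_zero]
        refine Eq.trans ?_ h1
        rw [mul_add, mul_add, mul_left_comm _ α, mul_left_comm _ β, mul_left_comm _ γ]
        rfl)
    (by refine mul_left_cancel₀ hg ?_
        rw [mul_zero]
        refine Eq.trans ?_ h2
        rw [mul_add, mul_add, mul_left_comm _ α, mul_left_comm _ β, mul_left_comm _ γ]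
        rfl)
  simp

lemma sum5 {A : Type*} [AddCommMonoid A] (f : ZMod 5 → A) : ∑ i, f i = f 0 + f 1 + f 2 + f 3 + f 4 := by
  exact Fin.sum_univ_five f

include hχ hW in
lemma F_fix : symRep ρ gW (∑ m, ZZ x m) = ∑ m, ZZ x m := by
  have hΦ := chi_phi χ hχ
  ext φ
  simp only [map_sum, Finset.sum_apply]
  have h1 : ∀ m, symRep ρ gW (ZZ x m) φ = gam (χ 1) ^ 3 * 
      ((∑ k, dd (χ 1) (k + m) * φ (x k)) ^ 2 * (∑ k, dd (χ 1) (k + (m + 2)) * φ (x k))) := by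
    intro m
    rw [ZZ, X3, symRep_mul, symRep_mul]
    simp only [Pi.mul_apply, W_X ρ x χ hW, mul_assoc, ← Finset.mul_sum]
    ring
  simp only [h1, ← Finset.mul_sum]
  have hg := gam_sq _ hΦ
  generalize χ 1 = ζ at *
  have hc := cub0 (ζ^2-ζ^9) (ζ^10-ζ^1) (ζ^6-ζ^5) (ζ^8-ζ^3) (ζ^7-ζ^4) (φ (x 0)) (φ (x 1)) (φ (x 2)) (φ (x 3)) (φ (x 4)) _
    (K0 ζ _ _ _ _ _ hΦ rfl rfl rfl rfl rfl)
    (K1 ζ _ _ _ _ _ hΦ rfl rfl rfl rfl rfl)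
    (K2 ζ _ _ _ _ _ hΦ rfl rfl rfl rfl rfl)
    (K3 ζ _ _ _ _ _ hΦ rfl rfl rfl rfl rfl)
    (K4 ζ _ _ _ _ _ hΦ rfl rfl rfl rfl rfl)
    (K5 ζ _ _ _ _ _ hΦ rfl rfl rfl rfl rfl)
    (K6 ζ _ _ _ _ _ hΦ rfl rfl rfl rfl rfl)
  have hl : (∑ m : ZMod 5, (∑ k, dd ζ (k + m) * φ (x k)) ^ 2 * (∑ k, dd ζ (k + (m + 2)) * φ (x k))) =
    11 * (1+2*(ζ+ζ^3+ζ^4+ζ^5+ζ^9)) * ∑ m, ZZ x m φ := by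
    rw [sum5 (fun m => (∑ k, dd ζ (k + m) * φ (x k)) ^ 2 * (∑ k, dd ζ (k + (m + 2)) * φ (x k))),
      sum5 (fun m => ZZ x m φ)]
    simp only [sum5]
    refine Eq.trans ?_ (hc.trans ?_)
    · rfl
    · have hz : ∀ m, ZZ x m φ = φ (x m) ^ 2 * φ (x (m + 2)) := by
        intro m; simp only [ZZ, X3, XX, Pi.mul_apply]; ring
      simp only [hz]
      rfl
  rw [hl]
  have h4 : gam ζ ^ 3 * (11 * (1+2*(ζ+ζ^3+ζ^4+ζ^5+ζ^9))) = 1 := by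
    have : 11 * (1+2*(ζ+ζ^3+ζ^4+ζ^5+ζ^9)) = 121 * gam ζ := by unfold gam; ring
    rw [this]
    linear_combination (121 * gam ζ ^ 2 - 11) * hg
  rw [← mul_assoc, h4, one_mul]
end
end P11

namespace P11
section
variable {V : Type} [AddCommGroup V] [Module ℂ V]
    (ρ : Representation ℂ PSL2F11 V)
    (x : Module.Basis (ZMod 5) ℂ V)
    (χ : AddChar (ZMod 11) ℂ) (hχ : χ.IsPrimitive)
    (ω : AddChar (ZMod 5) ℂ) (hω : ω.IsPrimitive)
    (hU : ∀ i j, ρ (gU j) (x i) = χ (j * 3 ^ i.val) • x i)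
    (hT : ∀ i j, ρ (gT j) (x i) = x (i + j))
    (hW : ∀ i, ρ gW (x i) = ∑ k, (gam (χ 1) * dd (χ 1) (k + i)) • x k)

include hT in
lemma T_ZZ (m j) : symRep ρ (gT j) (ZZ x m) = ZZ x (m + j) := by
  rw [ZZ, T_X3 ρ x hT, ZZ]
  congr 1; ring

include hU in
lemma U_ZZ (m j) : symRep ρ (gU j) (ZZ x m) = ZZ x m := by
  rw [ZZ, U_X3 ρ x χ hU]
  have : (3 ^ m.val + 3 ^ m.val + 3 ^ (m + 2).val : ZMod 11) = 0 := by revert m; decide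
  rw [this, mul_zero, AddChar.map_zero_eq_one, one_smul]

noncomputable def vv (k : ZMod 5) : Module.Dual ℂ V → ℂ := PT (symRep ρ) ω k (ZZ x 0)

include hχ hU in
lemma PU_ZZ (m) : PU (symRep ρ) χ 0 (ZZ x m) = ZZ x m := by
  rw [PU, pr_of_eig (AU (symRep ρ)) χ hχ 0 0, if_pos rfl]
  intro j
  rw [AU, U_ZZ ρ x χ hU, mul_zero, AddChar.map_zero_eq_one, one_smul]

include hχ hU in
lemma vv_eq (k) : vv ρ x ω k = PI (symRep ρ) χ ω k (ZZ x 0) := by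
  rw [PI, LinearMap.comp_apply, PU_ZZ ρ x χ hχ hU, vv]

include hχ hU in
lemma HW_vv (k) : HW (symRep ρ) ω k (vv ρ x ω k) := by
  rw [vv_eq ρ x χ hχ ω hU]; exact HW_PI _ _ _ _ _

lemma ZZ_mem (m) : ZZ x m ∈ symPow V 3 := X3_mem x _ _ _

include hχ hU in
lemma vv_mem (k) : vv ρ x ω k ∈ symPow V 3 := by
  rw [vv_eq ρ x χ hχ ω hU]
  exact PI_mem _ _ _ _ (symPow_stable ρ) _ _ (ZZ_mem x 0)

include hχ hU hT in
lemma PI_M (k y) (hy : y ∈ symPow V 3) : ∃ c : ℂ, c • vv ρ x ω k = PI (symRep ρ) χ ω k y := by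
  have h := PU_M ρ x χ hU hχ 0 y hy
  rw [← Submodule.mem_span_singleton, PI, LinearMap.comp_apply]
  have : Submodule.span ℂ {f | ∃ i j k : ZMod 5, (3 ^ i.val + 3 ^ j.val + 3 ^ k.val : ZMod 11) = 0 ∧ f = X3 x i j k}
      ≤ (Submodule.span ℂ {vv ρ x ω k}).comap (PT (symRep ρ) ω k) := by
    rw [Submodule.span_le]
    rintro f ⟨i, j, l, h, rfl⟩
    obtain ⟨m, hm⟩ := wt0 x i j l h
    simp only [Submodule.comap_coe, Set.mem_preimage, SetLike.mem_coe]
    have e : ZZ x m = AT (symRep ρ) m (ZZ x 0) := by rw [AT, T_ZZ ρ x hT, zero_add]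
    rw [hm, e, PT, pr_comp (AT (symRep ρ)) ω (AT_add _)]
    exact Submodule.smul_mem _ _ (Submodule.mem_span_singleton_self _)
  exact this h

include hT in
lemma vv_sum (k) : vv ρ x ω k = (5 : ℂ)⁻¹ • ∑ j, ω (-(j * k)) • ZZ x j := by
  rw [vv, PT, pr_apply]
  simp only [AT, T_ZZ ρ x hT, zero_add]
  norm_num

noncomputable def tv : ZMod 5 → ℂ := ![1, 0, 1, 0, 0]


include hT in
lemma vv_ne (k) : vv ρ x ω k ≠ 0 := by
  intro h
  have h1 := congrFun h (ev x tv)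
  rw [vv_sum ρ x ω hT, sum5] at h1
  have hz : ∀ m, ZZ x m (ev x tv) = tv m * tv m
     * tv (m + 2) := by
    intro m; simp only [ZZ, X3, Pi.mul_apply, XX_ev]
  have z0 : ZZ x 0 (ev x tv) = 1 := by
    rw [hz]; change (1 : ℂ) * 1 * 1 = 1; norm_num
  have z1 : ZZ x 1 (ev x tv) = 0 := by
    rw [hz]; change (0 : ℂ) * 0 * 0 = 0; norm_num
  have z2 : ZZ x 2 (ev x tv) = 0 := by
    rw [hz]; change (1 : ℂ) * 1 * 0 = 0; norm_num
  have z3 : ZZ x 3 (ev x tv) = 0 := by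
    rw [hz]; change (0 : ℂ) * 0 * 1 = 0; norm_num
  have z4 : ZZ x 4 (ev x tv) = 0 := by
    rw [hz]; change (0 : ℂ) * 0 * 0 = 0; norm_num
  simp [z0, z1, z2, z3, z4] at h1

include hχ hU hT hW in
lemma vv0_fix (g) : symRep ρ g (vv ρ x ω 0) = vv ρ x ω 0 := by
  have h := HW_vv ρ x χ hχ ω hU 0
  have hw : symRep ρ gW (vv ρ x ω 0) = vv ρ x ω 0 := by
    rw [vv_sum ρ x ω hT]
    simp only [mul_zero, neg_zero, AddChar.map_zero_eq_one, one_smul]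
    rw [map_smul, F_fix ρ x χ hχ hW]
  have ht : ∀ j, symRep ρ (gT j) (vv ρ x ω 0) = vv ρ x ω 0 := by
    intro j; rw [h.2]; simp
  rcases bruhat g with ⟨a, k, rfl⟩ | ⟨a, k, b, rfl⟩ <;>
    simp only [map_mul, Module.End.mul_apply, h.1, ht, hw]

include hχ hω hU hT in
lemma vv_neg (k) (hk : k ≠ 0) : vv ρ x ω (-k) ∈ SS (symRep ρ) (vv ρ x ω k) := by
  have h := HW_vv ρ x χ hχ ω hU k
  have hs := SS_stable (symRep ρ) ω k _ h
  have h1 : vp (symRep ρ) χ (vv ρ x ω k) ∈ SS (symRep ρ) (vv ρ x ω k) :=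
    pr_mem _ _ _ (fun j => hs _) _ _ (hs _ _ (mem_SS _ _))
  have h2 : vp (symRep ρ) χ (vv ρ x ω k) ≠ 0 := PW_ne (symRep ρ) χ ω hχ hω k hk _ h (vv_ne ρ x ω hT k) 0
  have h3 := PI_HW (symRep ρ) χ ω hχ hω (-k) (-k) _ (HW_vp (symRep ρ) χ ω k _ h)
  rw [if_pos rfl] at h3
  have h4 : vp (symRep ρ) χ (vv ρ x ω k) ∈ symPow V 3 :=
    SS_le _ _ _ (symPow_stable ρ) (vv_mem ρ x χ hχ ω hU k) h1
  obtain ⟨c, hc⟩ := PI_M ρ x χ hχ ω hU hT (-k) _ h4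
  rw [h3] at hc
  rw [← hc] at h1 h2
  have hc0 : c ≠ 0 := by rintro rfl; simp at h2
  exact (Submodule.smul_mem_iff _ hc0).mp h1

lemma PU0_PI (y : Module.Dual ℂ V → ℂ) (hω : ω.IsPrimitive) :
    PU (symRep ρ) χ 0 y = ∑ k, PI (symRep ρ) χ ω k y :=
  (pr_sum (AT (symRep ρ)) ω (AT_zero _) hω _).symm

include hχ hU in
/-- a coefficient functional vanishes if the relevant weight space is zero in a stable subspace -/
lemma BB_zero (U : Submodule ℂ (Module.Dual ℂ V → ℂ)) (hle : U ≤ symPow V 3)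
    (a b : ZMod 5) (y) (hy : y ∈ U)
    (h : PU (symRep ρ) χ (3 ^ a.val + 3 ^ a.val + 3 ^ b.val) y = 0) : BB x a b y = 0 := by
  rw [← pr_sum (AU (symRep ρ)) χ (AU_zero _) hχ y, map_sum]
  refine Finset.sum_eq_zero fun l _ => ?_
  by_cases hl : l = 3 ^ a.val + 3 ^ a.val + 3 ^ b.val
  · subst hl; rw [h, map_zero]
  · exact BB_wt ρ x χ hU hχ a b l y (hle hy) hl

/-- the weight `k` occurs in `U` -/
def Has (U : Submodule ℂ (Module.Dual ℂ V → ℂ)) (k : ZMod 11) : Prop :=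
  ∃ y ∈ U, PU (symRep ρ) χ k y ≠ 0

include hχ in
lemma Has_T (U : Submodule ℂ (Module.Dual ℂ V → ℂ)) (hU' : ∀ g, ∀ y ∈ U, symRep ρ g y ∈ U) (k : ZMod 11) (i : ZMod 5)
    (h : Has ρ χ U k) : Has ρ χ U (3 ^ i.val * k) := by
  obtain ⟨y, hy, hy0⟩ := h
  refine ⟨symRep ρ (gT i) (PU (symRep ρ) χ k y), hU' _ _ (pr_mem _ _ _ (fun j => hU' _) _ _ hy), ?_⟩
  rw [PU, pr_of_eig (AU (symRep ρ)) χ hχ (3 ^ i.val * k) _ _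
    (T_weight (symRep ρ) χ k i _ (fun j => pr_eig (AU (symRep ρ)) χ (AU_add _) k j y)), if_pos rfl]
  intro h
  have h2 : symRep ρ (gT (-i)) (symRep ρ (gT i) (PU (symRep ρ) χ k y)) = PU (symRep ρ) χ k y := by
    rw [← Module.End.mul_apply, ← map_mul, ← gT_add]; simp [gT_zero]
  rw [PU, h, map_zero] at h2
  exact hy0 h2.symm

include hχ in
lemma PU_idem (k : ZMod 11) (y) : PU (symRep ρ) χ k (PU (symRep ρ) χ k y) = PU (symRep ρ) χ k y := by
  rw [PU, pr_of_eig (AU (symRep ρ)) χ hχ k k _ (fun j => pr_eig (AU (symRep ρ)) χ (AU_add _) k j y), if_pos rfl]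

lemma orb1 (k : ZMod 11) (hk : k = 7 ∨ k = 6 ∨ k = 2) : ∃ i : ZMod 5, 3 ^ i.val * k = 10 := by
  revert k; decide
lemma orb (k : ZMod 11) (hk : k ≠ 0) : (∃ i : ZMod 5, 3 ^ i.val * k = 1) ∨ (∃ i : ZMod 5, 3 ^ i.val * k = 10) := by
  revert k; decide
lemma orb' (k : ZMod 11) (hk : k ≠ 0) : (∃ i : ZMod 5, 3 ^ i.val * 1 = k) ∨ (∃ i : ZMod 5, 3 ^ i.val * 10 = k) := by
  revert k; decide

include hχ hU hW in
lemma Has_all (U : Submodule ℂ (Module.Dual ℂ V → ℂ)) (hS : ∀ g, ∀ y ∈ U, symRep ρ g y ∈ U) (hle : U ≤ symPow V 3)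
    (h0 : ∀ y ∈ U, PU (symRep ρ) χ 0 y = 0) (hne : U ≠ ⊥) (k : ZMod 11) (hk : k ≠ 0) : Has ρ χ U k := by
  have hT' := Has_T ρ χ hχ U hS
  have hm : ∀ k, ∀ y ∈ U, PU (symRep ρ) χ k y ∈ U := fun k y hy => pr_mem _ _ _ (fun j => hS _) _ _ hy
  have a1 : Has ρ χ U 1 → Has ρ χ U 10 := by
    rintro ⟨y, hy, hy0⟩
    by_contra hcon
    apply hy0
    have hz : ∀ a b : ZMod 5, (∃ i : ZMod 5, 3 ^ i.val * (3 ^ a.val + 3 ^ a.val + 3 ^ b.val : ZMod 11) = 10) →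
        BB x a b (symRep ρ gW (PU (symRep ρ) χ 1 y)) = 0 := by
      rintro a b ⟨i, hi⟩
      refine BB_zero ρ x χ hχ hU U hle a b _ (hS _ _ (hm 1 y hy)) ?_
      by_contra hb
      exact hcon (hi ▸ hT' _ i ⟨_, hS _ _ (hm 1 y hy), hb⟩)
    exact nz1 ρ x χ hχ hU hW _ (hle (hm 1 y hy)) (PU_idem ρ χ hχ 1 y)
      (hz 0 3 (by decide)) (hz 0 4 (by decide)) (hz 3 1 (by decide))
  have a2 : Has ρ χ U 10 → Has ρ χ U 1 := by
    rintro ⟨y, hy, hy0⟩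
    by_contra hcon
    apply hy0
    have hz : ∀ a b : ZMod 5, (3 ^ a.val + 3 ^ a.val + 3 ^ b.val : ZMod 11) = 0 ∨ (∃ i : ZMod 5, 3 ^ i.val * (3 ^ a.val + 3 ^ a.val + 3 ^ b.val : ZMod 11) = 1) →
        BB x a b (symRep ρ gW (PU (symRep ρ) χ 10 y)) = 0 := by
      intro a b hab
      refine BB_zero ρ x χ hχ hU U hle a b _ (hS _ _ (hm 10 y hy)) ?_
      rcases hab with hi | ⟨i, hi⟩
      · rw [hi]; exact h0 _ (hS _ _ (hm 10 y hy))
      by_contra hb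
      exact hcon (hi ▸ hT' _ i ⟨_, hS _ _ (hm 10 y hy), hb⟩)
    exact nz10 ρ x χ hχ hU hW _ (hle (hm 10 y hy)) (PU_idem ρ χ hχ 10 y)
      (hz 0 1 (by decide)) (hz 3 0 (by decide)) (hz 4 1 (by decide))
  obtain ⟨y, hy, hy0⟩ := Submodule.exists_mem_ne_zero_of_ne_bot hne
  have hex : ∃ l, l ≠ 0 ∧ Has ρ χ U l := by
    by_contra! hcon
    apply hy0
    rw [← pr_sum (AU (symRep ρ)) χ (AU_zero _) hχ y]
    refine Finset.sum_eq_zero fun l _ => ?_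
    by_cases hl : l = 0
    · subst hl; exact h0 y hy
    · by_contra hb; exact hcon l hl ⟨y, hy, hb⟩
  obtain ⟨l, hl, hhl⟩ := hex
  have h1 : Has ρ χ U 1 := by
    rcases orb l hl with ⟨i, hi⟩ | ⟨i, hi⟩
    · exact hi ▸ hT' l i hhl
    · exact a2 (hi ▸ hT' l i hhl)
  rcases orb' k hk with ⟨i, hi⟩ | ⟨i, hi⟩
  · exact hi ▸ hT' 1 i h1
  · exact hi ▸ hT' 10 i (a1 h1)

include hχ in
lemma ten_le (U : Submodule ℂ (Module.Dual ℂ V → ℂ)) [FiniteDimensional ℂ U] (hS : ∀ g, ∀ y ∈ U, symRep ρ g y ∈ U)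
    (h : ∀ k, k ≠ 0 → Has ρ χ U k) : 10 ≤ Module.finrank ℂ U := by
  choose y hy hy0 using h
  let b : {k : ZMod 11 // k ≠ 0} → U := fun k =>
    ⟨PU (symRep ρ) χ k.1 (y k.1 k.2), pr_mem _ _ _ (fun j => hS _) _ _ (hy k.1 k.2)⟩
  have hli : LinearIndependent ℂ b := by
    rw [Fintype.linearIndependent_iff]
    intro g hg l
    have h := congrArg (fun u : U => PU (symRep ρ) χ l.1 u.1) hg
    simp only [Submodule.coe_sum, Submodule.coe_smul, map_sum, map_smul, Submodule.coe_zero, map_zero, b] at h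
    rw [Finset.sum_eq_single l] at h
    · rw [PU_idem ρ χ hχ, smul_eq_zero] at h
      exact h.resolve_right (hy0 l.1 l.2)
    · intro i _ hi
      rw [PU, pr_of_eig (AU (symRep ρ)) χ hχ i.1 l.1 _ (fun j => pr_eig (AU (symRep ρ)) χ (AU_add _) _ j _), if_neg, smul_zero]
      intro h; exact hi (Subtype.ext h).symm
    · simp
  have := hli.fintype_card_le_finrank
  simpa [Fintype.card_subtype_compl, ZMod.card] using this
end
end P11

namespace P11
lemma indep4 {E : Type*} [AddCommGroup E] [Module ℂ E] (A B C D : Submodule ℂ E)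
    (h : ∀ a ∈ A, ∀ b ∈ B, ∀ c ∈ C, ∀ d ∈ D, a + b + c + d = 0 → a = 0 ∧ b = 0 ∧ c = 0 ∧ d = 0) :
    iSupIndep ![A, B, C, D] := by
  classical
  rw [iSupIndep_iff_finsetSum_eq_zero_imp_eq_zero]
  intro s v hv hs
  let w : Fin 4 → E := fun i => if i ∈ s then v i else 0
  have hw : ∀ i, w i ∈ (![A, B, C, D] : Fin 4 → Submodule ℂ E) i := by
    intro i
    by_cases hi : i ∈ s
    · simpa only [w, if_pos hi] using hv i hi
    · simp only [w, if_neg hi]; exact Submodule.zero_mem _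
  have hsum : w 0 + w 1 + w 2 + w 3 = 0 := by
    rw [← Fin.sum_univ_four w, ← hs]
    simp [w, Finset.sum_ite_mem]
  obtain ⟨h0, h1, h2, h3⟩ := h _ (hw 0) _ (hw 1) _ (hw 2) _ (hw 3) hsum
  intro i hi
  have : w i = 0 := by
    fin_cases i
    · exact h0
    · exact h1
    · exact h2
    · exact h3
  simpa only [w, if_pos hi] using this
end P11

open P11 in
/-- Let `V` be an irreducible five-dimensional complex representation of the simple group
`PSL₂(F₁₁)`.  Then the third symmetric power `S³V` (of dimension `35`) decomposes as a direct
sum of one copy of the trivial representation, one irreducible representation of dimension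
`10`, and the two non-isomorphic irreducible representations of dimension `12`; in particular
`S³V` contains exactly one trivial subrepresentation. -/
theorem symCube_of_five_dim_irreducible_PSL2F11
    (V : Type) [AddCommGroup V] [Module ℂ V] [FiniteDimensional ℂ V]
    (ρ : Representation ℂ PSL2F11 V)
    (hdim : Module.finrank ℂ V = 5)
    (hirr : ∀ W : Submodule ℂ V,
      (∀ g : PSL2F11, ∀ v ∈ W, ρ g v ∈ W) → W = ⊥ ∨ W = ⊤) :
    Module.finrank ℂ (symPow V 3) = 35 ∧
    ∃ W₀ W₁ W₂ W₃ : Submodule ℂ (Module.Dual ℂ V → ℂ),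
      iSupIndep ![W₀, W₁, W₂, W₃] ∧
      W₀ ⊔ W₁ ⊔ W₂ ⊔ W₃ = symPow V 3 ∧
      IsSubrep ρ W₀ ∧ Module.finrank ℂ W₀ = 1 ∧
        (∀ g : PSL2F11, ∀ f ∈ W₀, symAct ρ g f = f) ∧
      IsIrredSubrep ρ W₁ ∧ Module.finrank ℂ W₁ = 10 ∧
      IsIrredSubrep ρ W₂ ∧ Module.finrank ℂ W₂ = 12 ∧
      IsIrredSubrep ρ W₃ ∧ Module.finrank ℂ W₃ = 12 ∧
      ¬ SubrepIso ρ W₂ W₃ ∧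
      (∀ f ∈ symPow V 3, (∀ g : PSL2F11, symAct ρ g f = f) → f ∈ W₀) := by
  obtain ⟨χ, hχ, x, hU, hT, hW⟩ := V_basis ρ hdim hirr
  have hω := ZMod.isPrimitive_stdAddChar 5
  generalize (ZMod.stdAddChar : AddChar (ZMod 5) ℂ) = ω at hω
  have h35 := symPow_finrank x
  refine ⟨h35, ?_⟩
  have fdM : FiniteDimensional ℂ (symPow V 3) := Module.finite_of_finrank_pos (by omega)
  have hM := symPow_stable ρ
  have hHW := HW_vv ρ x χ hχ ω hU
  have hmem := vv_mem ρ x χ hχ ω hU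
  have hne := vv_ne ρ x ω hT
  have hfix := vv0_fix ρ x χ hχ ω hU hT hW
  have hneg := vv_neg ρ x χ hχ ω hω hU hT
  have hPI := PI_M ρ x χ hχ ω hU hT
  have hPU := fun y => PU0_PI ρ χ ω y hω
  have hHas := Has_all ρ x χ hχ hU hW
  generalize vv ρ x ω = v at *
  have n1 : (1 : ZMod 5) ≠ 0 := by decide
  have n2 : (2 : ZMod 5) ≠ 0 := by decide
  have s1 := SS_stable (symRep ρ) ω 1 _ (hHW 1)
  have s2 := SS_stable (symRep ρ) ω 2 _ (hHW 2)
  have r1 := SS_finrank (symRep ρ) χ ω hχ hω 1 n1 _ (hHW 1) (hne 1)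
  have r2 := SS_finrank (symRep ρ) χ ω hχ hω 2 n2 _ (hHW 2) (hne 2)
  have i1 := SS_irred (symRep ρ) χ ω hχ hω 1 n1 _ (hHW 1) (hne 1)
  have i2 := SS_irred (symRep ρ) χ ω hχ hω 2 n2 _ (hHW 2) (hne 2)
  have z1 := fun l => PI_SS_zero (symRep ρ) χ ω hχ hω 1 l _ (hHW 1)
  have z2 := fun l => PI_SS_zero (symRep ρ) χ ω hχ hω 2 l _ (hHW 2)
  have l1 := SS_le (symRep ρ) (v 1) _ hM (hmem 1)
  have l2 := SS_le (symRep ρ) (v 2) _ hM (hmem 2)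
  have m1 := mem_SS (symRep ρ) (v 1)
  have m2 := mem_SS (symRep ρ) (v 2)
  have m4 := hneg 1 n1
  have m3 := hneg 2 n2
  have hPH := PI_HW (symRep ρ) χ ω hχ hω
  generalize SS (symRep ρ) (v 1) = W₂ at *
  generalize SS (symRep ρ) (v 2) = W₃ at *
  have fix0 : ∀ g : PSL2F11, ∀ f ∈ Submodule.span ℂ {v 0}, symRep ρ g f = f := by
    intro g f hf
    obtain ⟨c, rfl⟩ := Submodule.mem_span_singleton.mp hf
    rw [map_smul, hfix]
  have r0 : Module.finrank ℂ (Submodule.span ℂ {v 0}) = 1 := finrank_span_singleton (hne 0)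
  have p0 : ∀ f ∈ Submodule.span ℂ {v 0}, PI (symRep ρ) χ ω 0 f = f := by
    intro f hf
    obtain ⟨c, rfl⟩ := Submodule.mem_span_singleton.mp hf
    rw [map_smul, hPH 0 0 _ (hHW 0), if_pos rfl]
  have l0 : Submodule.span ℂ {v 0} ≤ symPow V 3 := by
    rw [Submodule.span_singleton_le_iff_mem]; exact hmem 0
  have m0 : v 0 ∈ Submodule.span ℂ {v 0} := Submodule.mem_span_singleton_self _
  have last : ∀ f ∈ symPow V 3, (∀ g : PSL2F11, symRep ρ g f = f) → f ∈ Submodule.span ℂ {v 0} := by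
    intro f hf hg
    have h0 : HW (symRep ρ) ω 0 f := ⟨fun j => hg _, fun j => by rw [hg]; simp⟩
    obtain ⟨c, hc⟩ := hPI 0 f hf
    rw [hPH 0 0 f h0, if_pos rfl] at hc
    exact Submodule.mem_span_singleton.mpr ⟨c, hc⟩
  generalize Submodule.span ℂ {v 0} = W₀ at *
  have q23 : W₂ ⊓ W₃ = ⊥ := by
    rcases i1 (W₂ ⊓ W₃) (fun g y hy => ⟨s1 g y hy.1, s2 g y hy.2⟩) inf_le_left with h | h
    · exact h
    · exfalso
      have h3 : v 1 ∈ W₃ := by rw [← h] at m1; exact m1.2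
      have := z2 1 (v 1) h3 (by decide) (by decide)
      rw [hPH 1 1 _ (hHW 1), if_pos rfl] at this
      exact hne 1 this
  have pz : ∀ y ∈ W₂ ⊔ W₃, PI (symRep ρ) χ ω 0 y = 0 := by
    intro y hy
    obtain ⟨a, ha, b, hb, rfl⟩ := Submodule.mem_sup.mp hy
    rw [map_add, z1 0 a ha (by decide) (by decide), z2 0 b hb (by decide) (by decide), add_zero]
  have q0 : W₀ ⊓ (W₂ ⊔ W₃) = ⊥ := by
    rw [eq_bot_iff]
    rintro y ⟨h1, h2⟩
    rw [Submodule.mem_bot, ← p0 y h1, pz y h2]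
  have lN : W₀ ⊔ (W₂ ⊔ W₃) ≤ symPow V 3 := sup_le l0 (sup_le l1 l2)
  have sN : ∀ g, ∀ y ∈ W₀ ⊔ (W₂ ⊔ W₃), symRep ρ g y ∈ W₀ ⊔ (W₂ ⊔ W₃) := by
    intro g y hy
    obtain ⟨a, ha, b, hb, rfl⟩ := Submodule.mem_sup.mp hy
    obtain ⟨c, hc, d, hd, rfl⟩ := Submodule.mem_sup.mp hb
    rw [map_add, map_add, fix0 g a ha]
    exact Submodule.add_mem_sup ha (Submodule.add_mem_sup (s1 g c hc) (s2 g d hd))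
  have mN : ∀ k, v k ∈ W₀ ⊔ (W₂ ⊔ W₃) := by
    have c0 : W₀ ≤ W₀ ⊔ (W₂ ⊔ W₃) := le_sup_left
    have c2 : W₂ ≤ W₀ ⊔ (W₂ ⊔ W₃) := le_sup_left.trans le_sup_right
    have c3 : W₃ ≤ W₀ ⊔ (W₂ ⊔ W₃) := le_sup_right.trans le_sup_right
    intro k
    have hk : k = 0 ∨ k = 1 ∨ k = 2 ∨ k = -2 ∨ k = -1 := by revert k; decide
    rcases hk with rfl | rfl | rfl | rfl | rfl
    · exact c0 m0
    · exact c2 m1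
    · exact c3 m2
    · exact c3 m3
    · exact c2 m4
  have fd0 : FiniteDimensional ℂ W₀ := Submodule.finiteDimensional_of_le l0
  have fd2 : FiniteDimensional ℂ W₂ := Submodule.finiteDimensional_of_le l1
  have fd3 : FiniteDimensional ℂ W₃ := Submodule.finiteDimensional_of_le l2
  obtain ⟨W₁, lW, sW, iW, uW⟩ := maschke (symRep ρ) _ _ sN hM lN
  have fd1 : FiniteDimensional ℂ W₁ := Submodule.finiteDimensional_of_le lW
  have rW : Module.finrank ℂ W₁ = 10 := by
    have e1 := Submodule.finrank_sup_add_finrank_inf_eq W₂ W₃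
    have e2 := Submodule.finrank_sup_add_finrank_inf_eq W₀ (W₂ ⊔ W₃)
    have e3 := Submodule.finrank_sup_add_finrank_inf_eq (W₀ ⊔ (W₂ ⊔ W₃)) W₁
    rw [q23, finrank_bot] at e1
    rw [q0, finrank_bot] at e2
    rw [iW, uW, finrank_bot] at e3
    omega
  have k1 : ∀ y ∈ W₁, PU (symRep ρ) χ 0 y = 0 := by
    intro y hy
    have a1 : PU (symRep ρ) χ 0 y ∈ W₁ := pr_mem _ _ _ (fun j => sW _) _ _ hy
    have a2 : PU (symRep ρ) χ 0 y ∈ W₀ ⊔ (W₂ ⊔ W₃) := by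
      rw [hPU]
      refine Submodule.sum_mem _ fun k _ => ?_
      obtain ⟨c, hc⟩ := hPI k y (lW hy)
      rw [← hc]
      exact Submodule.smul_mem _ _ (mN k)
    have : PU (symRep ρ) χ 0 y ∈ (W₀ ⊔ (W₂ ⊔ W₃)) ⊓ W₁ := ⟨a2, a1⟩
    rwa [iW] at this
  have nb : ∀ W : Submodule ℂ (Module.Dual ℂ V → ℂ), 0 < Module.finrank ℂ W → W ≠ ⊥ := by
    rintro W h rfl
    rw [finrank_bot] at h; omega
  refine ⟨W₀, W₁, W₂, W₃, ?_, ?_, ?_, r0, fix0, ⟨sW, nb _ (by omega), ?_⟩, rW,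
    ⟨s1, nb _ (by omega), fun U hle hs => i1 U hs hle⟩, r1,
    ⟨s2, nb _ (by omega), fun U hle hs => i2 U hs hle⟩, r2, ?_, last⟩
  · refine indep4 _ _ _ _ fun a ha b hb c hc d hd h => ?_
    have hb0 : b = 0 := by
      have e : b = -(a + (c + d)) := by
        rw [eq_neg_iff_add_eq_zero, ← h]; abel
      have : b ∈ (W₀ ⊔ (W₂ ⊔ W₃)) ⊓ W₁ :=
        ⟨e ▸ Submodule.neg_mem _ (Submodule.add_mem_sup ha (Submodule.add_mem_sup hc hd)), hb⟩
      rwa [iW] at this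
    subst hb0
    have ha0 : a = 0 := by
      have e : a = -(c + d) := by
        rw [eq_neg_iff_add_eq_zero, ← h]; abel
      have : a ∈ W₀ ⊓ (W₂ ⊔ W₃) :=
        ⟨ha, e ▸ Submodule.neg_mem _ (Submodule.add_mem_sup hc hd)⟩
      rwa [q0] at this
    subst ha0
    have hc0 : c = 0 := by
      have e : c = -d := by
        rw [eq_neg_iff_add_eq_zero, ← h]; abel
      have : c ∈ W₂ ⊓ W₃ := ⟨hc, e ▸ Submodule.neg_mem _ hd⟩
      rwa [q23] at this
    subst hc0
    exact ⟨rfl, rfl, rfl, by simpa using h⟩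
  · rw [← uW]; ac_rfl
  · intro g f hf
    have := fix0 g f hf
    change symRep ρ g f ∈ W₀
    rwa [this]
  · intro U hle hs
    by_cases hb : U = ⊥
    · exact Or.inl hb
    · right
      have fdU : FiniteDimensional ℂ U := Submodule.finiteDimensional_of_le (hle.trans lW)
      have := ten_le ρ χ hχ U hs (hHas U hs (hle.trans lW) (fun y hy => k1 y (hle hy)) hb)
      exact Submodule.eq_of_le_of_finrank_le hle (by omega)
  · rintro ⟨T, hT1, hT2, hT3⟩
    have e : T (v 1) ∈ W₃ := hT1 ▸ Submodule.mem_map_of_mem m1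
    have e3 : ∀ g, symRep ρ g (T (v 1)) = T (symRep ρ g (v 1)) := fun g => (hT3 g _ m1).symm
    have e1 : HW (symRep ρ) ω 1 (T (v 1)) := by
      refine ⟨fun j => ?_, fun j => ?_⟩
      · rw [e3, (hHW 1).1]
      · rw [e3, (hHW 1).2, map_smul]
    have := z2 1 _ e (by decide) (by decide)
    rw [hPH 1 1 _ e1, if_pos rfl] at this
    exact hne 1 (hT2 _ m1 this)
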